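/- arXiv:2001.09962 — 2 statements merged into one kernel-verified Lean document; each statement's English description precedes it below -/
import Mathlib

section
/- Let Φ be a unital positive linear map on B(H) and let f : (0,∞) → (0,∞) be a continuous function such that f² is operator concave and f(t) ≥ 1 for all t > 0. Then for every positive invertible operator A ∈ B(H), the chain of inequalities Φ(A f(A)^{-1}) ≤ |Φ(f(A))^{-1} Φ(A)| ≤ |Φ(f(A)) Φ(A)| ≤ Φ(A f(A)) holds. -/
open scoped NNReal

variable {H : Type*} [NormedAddCommGroup H] [InnerProductSpace ℂ H] [CompleteSpace H]

/-- The absolute value `|X| = (X*X)^(1/2)` of a bounded operator `X` on a Hilbert space. -/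
noncomputable def opAbs (X : H →L[ℂ] H) : H →L[ℂ] H := CFC.sqrt (star X * X)

/-- `Φ` is a unital positive linear map on `B(H)`: `Φ(I) = I` and `Φ(X) ≥ 0` whenever `X ≥ 0`
(with respect to the Löwner order). -/
def IsUnitalPositiveMap (Φ : (H →L[ℂ] H) →ₗ[ℂ] (H →L[ℂ] H)) : Prop :=
  Φ 1 = 1 ∧ ∀ X : H →L[ℂ] H, 0 ≤ X → 0 ≤ Φ X

/-- `f : (0,∞) → (0,∞)` is operator convex: for all positive invertible operators `A, B` on `H`
and all `c ∈ [0,1]`, `f(cA + (1-c)B) ≤ c f(A) + (1-c) f(B)` in the Löwner order, where `f(A)` is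
given by the continuous functional calculus. -/
def IsOperatorConvexOn (H : Type*) [NormedAddCommGroup H] [InnerProductSpace ℂ H]
    [CompleteSpace H] (f : ℝ → ℝ) : Prop :=
  ∀ (A B : H →L[ℂ] H), 0 ≤ A → IsUnit A → 0 ≤ B → IsUnit B →
    ∀ c : ℝ, c ∈ Set.Icc (0 : ℝ) 1 →
      cfc f (c • A + (1 - c) • B) ≤ c • cfc f A + (1 - c) • cfc f B

/-- `f : (0,∞) → (0,∞)` is operator concave if `-f` is operator convex. -/
def IsOperatorConcaveOn (H : Type*) [NormedAddCommGroup H] [InnerProductSpace ℂ H]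
    [CompleteSpace H] (f : ℝ → ℝ) : Prop :=
  IsOperatorConvexOn H (fun t => -(f t))

set_option linter.unusedSectionVars false

open Polynomial in
/-- Sums of squares of real polynomials of degree at most `m`. -/
noncomputable def sqCone (m : ℕ) : AddSubmonoid ℝ[X] :=
  AddSubmonoid.closure {p | ∃ q : ℝ[X], q.natDegree ≤ m ∧ p = q ^ 2}

open Polynomial in
/-- The cone generated by `q²` with `deg q ≤ m` and `(X - a) (X - b) q²` with `deg q < m`. -/
noncomputable def evenCone (a b : ℝ) (m : ℕ) : AddSubmonoid ℝ[X] :=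
  AddSubmonoid.closure ({p | ∃ q : ℝ[X], q.natDegree ≤ m ∧ p = q ^ 2} ∪
    {p | ∃ q : ℝ[X], q.natDegree + 1 ≤ m ∧ p = (X - C a) * (X - C b) * q ^ 2})

open Polynomial in
/-- The cone generated by `(X - a) q²` and `(X - b) q²` with `deg q ≤ m`. -/
noncomputable def oddCone (a b : ℝ) (m : ℕ) : AddSubmonoid ℝ[X] :=
  AddSubmonoid.closure {p | ∃ q : ℝ[X], q.natDegree ≤ m ∧
    (p = (X - C a) * q ^ 2 ∨ p = (X - C b) * q ^ 2)}

section PolynomialCones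

open Polynomial Topology

theorem Polynomial.eval_nonneg_of_forall_ne {U : Set ℝ} (hU : IsOpen U) {r : ℝ[X]} {c : ℝ}
    (h : ∀ t ∈ U, t ≠ c → 0 ≤ r.eval t) : ∀ t ∈ U, 0 ≤ r.eval t := by
  intro t ht
  rcases ne_or_eq t c with hc | rfl
  · exact h t ht hc
  by_contra! hneg
  have h1 : ∀ᶠ s in 𝓝[≠] t, r.eval s < 0 :=
    (r.continuous.continuousAt.eventually_lt continuousAt_const hneg).filter_mono nhdsWithin_le_nhds
  have h2 : ∀ᶠ s in 𝓝[≠] t, s ∈ U := (hU.eventually_mem ht).filter_mono nhdsWithin_le_nhds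
  obtain ⟨s, hs1, hs2, hs3⟩ := (h1.and (h2.and self_mem_nhdsWithin)).exists
  exact absurd (h s hs2 hs3) (not_le.mpr hs1)

theorem Polynomial.exists_eq_sq_mul {p : ℝ[X]} {c : ℝ} (hc : p.eval c = 0)
    (hp : ∀ t, 0 ≤ p.eval t) : ∃ r : ℝ[X], p = (X - C c) ^ 2 * r := by
  obtain ⟨r, rfl⟩ := dvd_iff_isRoot.mpr hc
  have hmin : IsLocalMin (fun t => ((X - C c) * r).eval t) c :=
    Filter.Eventually.of_forall fun t => by simpa only [hc] using hp t
  have hd := hmin.deriv_eq_zero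
  rw [Polynomial.deriv] at hd
  have hr : r.eval c = 0 := by simpa using hd
  obtain ⟨s, rfl⟩ := dvd_iff_isRoot.mpr hr
  exact ⟨s, by ring⟩

theorem mul_sq_mem_sqCone {m k : ℕ} {p q : ℝ[X]} (hq : q.natDegree ≤ k) (hp : p ∈ sqCone m) :
    q ^ 2 * p ∈ sqCone (m + k) := by
  induction hp using AddSubmonoid.closure_induction with
  | mem x hx =>
    obtain ⟨s, hs, rfl⟩ := hx
    refine AddSubmonoid.subset_closure ⟨q * s, ?_, by ring⟩
    exact natDegree_mul_le.trans (by omega)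
  | zero => simp
  | add x y _ _ hx hy => rw [mul_add]; exact add_mem hx hy

theorem C_mem_sqCone {c : ℝ} (hc : 0 ≤ c) (m : ℕ) : C c ∈ sqCone m :=
  AddSubmonoid.subset_closure ⟨C √c, by simp, by rw [← C_pow, Real.sq_sqrt hc]⟩

theorem natDegree_le_of_sq_mul {r : ℝ[X]} {c : ℝ} {m : ℕ}
    (h : ((X - C c) ^ 2 * r).natDegree ≤ 2 * (m + 1)) : r.natDegree ≤ 2 * m := by
  by_cases hr : r = 0
  · simp [hr]
  rw [((monic_X_sub_C c).pow 2).natDegree_mul' hr, (monic_X_sub_C c).natDegree_pow,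
    natDegree_X_sub_C] at h
  omega

theorem mem_sqCone_of_nonneg (m : ℕ) : ∀ p : ℝ[X], p.natDegree ≤ 2 * m →
    (∀ t, 0 ≤ p.eval t) → p ∈ sqCone m := by
  induction m with
  | zero =>
    intro p hp h
    rw [eq_C_of_natDegree_le_zero hp] at h ⊢
    exact C_mem_sqCone (by simpa using h 0) 0
  | succ m ih =>
    intro p hp h
    by_cases hd : 0 < p.degree
    · have htend : Filter.Tendsto (fun t => p.eval t) (Filter.cocompact ℝ) Filter.atTop := by
        have := p.tendsto_norm_atTop hd (tendsto_norm_cocompact_atTop (E := ℝ))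
        refine this.congr fun t => ?_
        rw [Real.norm_of_nonneg (h t)]
      obtain ⟨c, hc⟩ := p.continuous.exists_forall_le htend
      obtain ⟨r, hr⟩ := exists_eq_sq_mul (p := p - C (p.eval c)) (c := c) (by simp)
        (fun t => by simpa using hc t)
      have hr0 : ∀ t, 0 ≤ r.eval t := fun t =>
        eval_nonneg_of_forall_ne isOpen_univ (c := c) (fun t _ ht => by
          have h1 : 0 ≤ (p - C (p.eval c)).eval t := by simpa using hc t
          rw [hr, eval_mul] at h1
          refine nonneg_of_mul_nonneg_right h1 ?_
          have : t - c ≠ 0 := sub_ne_zero.mpr ht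
          simp only [eval_pow, eval_sub, eval_X, eval_C]; positivity) t trivial
      have hrd : r.natDegree ≤ 2 * m := by
        refine natDegree_le_of_sq_mul (c := c) ?_
        rw [← hr, natDegree_sub_C]; exact hp
      have hp' : p = (X - C c) ^ 2 * r + C (p.eval c) := by rw [← hr]; ring
      rw [hp']
      exact add_mem (mul_sq_mem_sqCone (natDegree_X_sub_C_le c) (ih r hrd hr0))
        (C_mem_sqCone (h c) _)
    · rw [eq_C_of_degree_le_zero (not_lt.mp hd)] at h ⊢
      exact C_mem_sqCone (by simpa using h 0) _

theorem sqCone_le_evenCone (a b : ℝ) (m : ℕ) : sqCone m ≤ evenCone a b m :=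
  AddSubmonoid.closure_mono Set.subset_union_left

theorem linear_eq_combination {a b c : ℝ} (hab : a < b) (hc : c ∈ Set.Icc a b) :
    ∃ α β : ℝ, (X - C c : ℝ[X]) = C α ^ 2 * (X - C a) + C β ^ 2 * (X - C b) := by
  have hba : 0 < b - a := sub_pos.mpr hab
  refine ⟨√((b - c) / (b - a)), √((c - a) / (b - a)), ?_⟩
  rw [← C_pow, ← C_pow, Real.sq_sqrt (div_nonneg (sub_nonneg.mpr hc.2) hba.le),
    Real.sq_sqrt (div_nonneg (sub_nonneg.mpr hc.1) hba.le)]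
  refine Polynomial.funext fun t => ?_
  simp only [eval_add, eval_mul, eval_sub, eval_X, eval_C]
  field_simp
  ring

theorem linear_mul_mem_oddCone {a b c : ℝ} (hab : a < b) (hc : c ∈ Set.Icc a b) {m : ℕ} {r : ℝ[X]}
    (hr : r ∈ evenCone a b m) : (X - C c) * r ∈ oddCone a b m := by
  obtain ⟨α, β, hαβ⟩ := linear_eq_combination hab hc
  have hdeg : ∀ (γ d : ℝ) (q : ℝ[X]), q.natDegree + 1 ≤ m →
      (C γ * ((X - C d) * q)).natDegree ≤ m := fun γ d q hq =>
    (natDegree_C_mul_le _ _).trans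
      (natDegree_mul_le.trans (by rw [natDegree_X_sub_C]; omega))
  induction hr using AddSubmonoid.closure_induction with
  | mem x hx =>
    rcases hx with ⟨q, hq, rfl⟩ | ⟨q, hq, rfl⟩
    · have : (X - C c) * q ^ 2 = (X - C a) * (C α * q) ^ 2 + (X - C b) * (C β * q) ^ 2 := by
        rw [hαβ]; ring
      rw [this]
      exact add_mem
        (AddSubmonoid.subset_closure ⟨_, (natDegree_C_mul_le _ _).trans hq, Or.inl rfl⟩)
        (AddSubmonoid.subset_closure ⟨_, (natDegree_C_mul_le _ _).trans hq, Or.inr rfl⟩)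
    · have : (X - C c) * ((X - C a) * (X - C b) * q ^ 2) =
          (X - C b) * (C α * ((X - C a) * q)) ^ 2 + (X - C a) * (C β * ((X - C b) * q)) ^ 2 := by
        rw [hαβ]; ring
      rw [this]
      exact add_mem (AddSubmonoid.subset_closure ⟨_, hdeg _ _ _ hq, Or.inr rfl⟩)
        (AddSubmonoid.subset_closure ⟨_, hdeg _ _ _ hq, Or.inl rfl⟩)
  | zero => simp
  | add x y _ _ hx hy => rw [mul_add]; exact add_mem hx hy

theorem linear_mul_mem_evenCone {a b c : ℝ} (hab : a < b) (hc : c ∈ Set.Icc a b) {m : ℕ}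
    {r : ℝ[X]} (hr : r ∈ oddCone a b m) : (X - C c) * r ∈ evenCone a b (m + 1) := by
  obtain ⟨α, β, hαβ⟩ := linear_eq_combination hab hc
  have hsq : ∀ (γ d : ℝ) (q : ℝ[X]), q.natDegree ≤ m →
      (C γ * ((X - C d) * q)) ^ 2 ∈ evenCone a b (m + 1) := fun γ d q hq =>
    AddSubmonoid.subset_closure (Or.inl ⟨_, (natDegree_C_mul_le _ _).trans
      (natDegree_mul_le.trans (by rw [natDegree_X_sub_C]; omega)), rfl⟩)
  have hab' : ∀ (γ : ℝ) (q : ℝ[X]), q.natDegree ≤ m →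
      (X - C a) * (X - C b) * (C γ * q) ^ 2 ∈ evenCone a b (m + 1) := fun γ q hq =>
    AddSubmonoid.subset_closure (Or.inr ⟨_, Nat.succ_le_succ
      ((natDegree_C_mul_le _ _).trans hq), rfl⟩)
  induction hr using AddSubmonoid.closure_induction with
  | mem x hx =>
    obtain ⟨q, hq, rfl | rfl⟩ := hx
    · have : (X - C c) * ((X - C a) * q ^ 2) =
          (C α * ((X - C a) * q)) ^ 2 + (X - C a) * (X - C b) * (C β * q) ^ 2 := by
        rw [hαβ]; ring
      rw [this]
      exact add_mem (hsq _ _ _ hq) (hab' _ _ hq)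
    · have : (X - C c) * ((X - C b) * q ^ 2) =
          (C β * ((X - C b) * q)) ^ 2 + (X - C a) * (X - C b) * (C α * q) ^ 2 := by
        rw [hαβ]; ring
      rw [this]
      exact add_mem (hsq _ _ _ hq) (hab' _ _ hq)
  | zero => simp
  | add x y _ _ hx hy => rw [mul_add]; exact add_mem hx hy

theorem natDegree_le_of_linear_mul {r : ℝ[X]} {c : ℝ} {d : ℕ}
    (h : ((X - C c) * r).natDegree ≤ d + 1) : r.natDegree ≤ d := by
  by_cases hr : r = 0
  · simp [hr]
  rw [(monic_X_sub_C c).natDegree_mul' hr, natDegree_X_sub_C] at h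
  omega

theorem eval_nonneg_left {p : ℝ[X]} {a : ℝ} (h : ∀ t < a, 0 ≤ p.eval t) : 0 ≤ p.eval a := by
  have h1 : Filter.Tendsto (fun t => p.eval t) (𝓝[<] a) (𝓝 (p.eval a)) :=
    p.continuous.continuousAt.tendsto.mono_left nhdsWithin_le_nhds
  exact ge_of_tendsto h1 (Filter.eventually_of_mem self_mem_nhdsWithin h)

theorem eval_nonneg_right {p : ℝ[X]} {b : ℝ} (h : ∀ t > b, 0 ≤ p.eval t) : 0 ≤ p.eval b := by
  have h1 : Filter.Tendsto (fun t => p.eval t) (𝓝[>] b) (𝓝 (p.eval b)) :=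
    p.continuous.continuousAt.tendsto.mono_left nhdsWithin_le_nhds
  exact ge_of_tendsto h1 (Filter.eventually_of_mem self_mem_nhdsWithin h)

theorem mem_oddCone_of_evenCone {a b : ℝ} (hab : a < b) {m : ℕ}
    (hE : ∀ p : ℝ[X], p.natDegree ≤ 2 * m → (∀ t < a, 0 ≤ p.eval t) → (∀ t > b, 0 ≤ p.eval t) →
      p ∈ evenCone a b m)
    {p : ℝ[X]} (hp : p.natDegree ≤ 2 * m + 1) (ha : ∀ t < a, p.eval t ≤ 0)
    (hb : ∀ t > b, 0 ≤ p.eval t) : p ∈ oddCone a b m := by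
  have h1 : p.eval a ≤ 0 := by
    have := eval_nonneg_left (p := -p) (a := a) fun t ht => by simpa using ha t ht
    simpa using this
  obtain ⟨c, hc, hc0⟩ := intermediate_value_Icc hab.le p.continuous.continuousOn
    (show (0 : ℝ) ∈ Set.Icc (p.eval a) (p.eval b) from ⟨h1, eval_nonneg_right hb⟩)
  obtain ⟨r, rfl⟩ := dvd_iff_isRoot.mpr hc0
  refine linear_mul_mem_oddCone hab hc (hE r (natDegree_le_of_linear_mul hp) ?_ ?_)
  · intro t ht
    have := ha t ht
    rw [eval_mul] at this
    simp only [eval_sub, eval_X, eval_C] at this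
    exact nonneg_of_mul_nonpos_right this (by linarith [hc.1])
  · intro t ht
    have := hb t ht
    rw [eval_mul] at this
    simp only [eval_sub, eval_X, eval_C] at this
    exact nonneg_of_mul_nonneg_right this (by linarith [hc.2])

theorem mem_evenCone {a b : ℝ} (hab : a < b) (m : ℕ) : ∀ p : ℝ[X], p.natDegree ≤ 2 * m →
    (∀ t < a, 0 ≤ p.eval t) → (∀ t > b, 0 ≤ p.eval t) → p ∈ evenCone a b m := by
  induction m with
  | zero =>
    intro p hp ha _
    refine sqCone_le_evenCone _ _ _ ?_
    rw [eq_C_of_natDegree_le_zero hp] at ha ⊢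
    exact C_mem_sqCone (by simpa using ha (a - 1) (by linarith)) 0
  | succ m ih =>
    intro p hp ha hb
    by_cases hroot : ∃ c ∈ Set.Icc a b, p.eval c = 0
    · obtain ⟨c, hc, hc0⟩ := hroot
      obtain ⟨r, rfl⟩ := dvd_iff_isRoot.mpr hc0
      refine linear_mul_mem_evenCone hab hc
        (mem_oddCone_of_evenCone hab ih (natDegree_le_of_linear_mul hp) ?_ ?_)
      · intro t ht
        have := ha t ht
        rw [eval_mul] at this
        simp only [eval_sub, eval_X, eval_C] at this
        exact nonpos_of_mul_nonneg_right this (by linarith [hc.1])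
      · intro t ht
        have := hb t ht
        rw [eval_mul] at this
        simp only [eval_sub, eval_X, eval_C] at this
        exact nonneg_of_mul_nonneg_right this (by linarith [hc.2])
    · push Not at hroot
      refine sqCone_le_evenCone _ _ _ (mem_sqCone_of_nonneg _ p hp fun t => ?_)
      rcases lt_or_ge t a with h | h
      · exact ha t h
      rcases lt_or_ge b t with hbt | hbt
      · exact hb t hbt
      by_contra! hneg
      obtain ⟨c, hc, hc0⟩ := intermediate_value_Icc' h p.continuous.continuousOn
        (show (0 : ℝ) ∈ Set.Icc (p.eval t) (p.eval a) from ⟨hneg.le, eval_nonneg_left ha⟩)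
      exact hroot c ⟨hc.1, hc.2.trans hbt⟩ hc0

/-- A polynomial that is nonpositive to the left of `[a, b]` and nonnegative to the right of it is
a sum of terms `(X - a) q²` and `(X - b) q²`. -/
theorem mem_oddCone {a b : ℝ} (hab : a < b) {m : ℕ} {p : ℝ[X]} (hp : p.natDegree ≤ 2 * m + 1)
    (ha : ∀ t < a, p.eval t ≤ 0) (hb : ∀ t > b, 0 ≤ p.eval t) : p ∈ oddCone a b m :=
  mem_oddCone_of_evenCone hab (mem_evenCone hab m) hp ha hb

end PolynomialCones

section DividedDifferences

open Polynomial Lagrange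

/-- Nonnegativity of the divided differences of `u² h` over `2 N - 1` positive nodes, for all
polynomials `u` of degree at most `N - 2`. -/
def DividedDifferenceConvex (N : ℕ) (h : ℝ → ℝ) : Prop :=
  ∀ Y : Finset ℝ, (∀ y ∈ Y, 0 < y) → Y.card + 1 = 2 * N → ∀ u : ℝ[X], u.natDegree + 2 ≤ N →
    0 ≤ ∑ y ∈ Y, nodalWeight Y id y * (u.eval y ^ 2 * h y)

theorem nodalWeight_mul_sub_eq_erase {S : Finset ℝ} {a x : ℝ} (ha : a ∈ S) (hxa : x ≠ a) :
    nodalWeight S id x * (x - a) = nodalWeight (S.erase a) id x := by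
  have h1 : a ∈ S.erase x := Finset.mem_erase.mpr ⟨hxa.symm, ha⟩
  have h2 : x - a ≠ 0 := sub_ne_zero.mpr hxa
  simp only [nodalWeight, id]
  rw [← Finset.mul_prod_erase _ _ h1, Finset.erase_right_comm]
  field_simp

theorem sum_nodalWeight_linear_mul {S : Finset ℝ} {a : ℝ} (ha : a ∈ S) (h : ℝ → ℝ) :
    ∑ x ∈ S, nodalWeight S id x * ((x - a) * h x) =
      ∑ x ∈ S.erase a, nodalWeight (S.erase a) id x * h x := by
  rw [← Finset.add_sum_erase _ _ ha]
  simp only [sub_self, zero_mul, mul_zero, zero_add]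
  refine Finset.sum_congr rfl fun x hx => ?_
  rw [← nodalWeight_mul_sub_eq_erase ha (Finset.ne_of_mem_erase hx), mul_assoc]

theorem eval_interpolate_div_nodalWeight (S : Finset ℝ) (c : ℝ → ℝ) {y : ℝ} (hy : y ∉ S) :
    (interpolate S id fun x => c x / nodalWeight S id x).eval y =
      (∏ x ∈ S, (y - x)) * ∑ x ∈ S, c x / (y - x) := by
  rw [eval_interpolate_not_at_node _ fun i hi h => hy (by rw [h]; exact hi), eval_nodal]
  refine congrArg _ (Finset.sum_congr rfl fun x hx => ?_)
  have := nodalWeight_ne_zero (v := id) (s := S) Function.injective_id.injOn hx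
  simp only [id] at *
  field_simp

theorem exists_polynomial_of_sum_eq_zero {N : ℕ} {S : Finset ℝ} (hS : S.card = 2 * N)
    {c : ℝ → ℝ} (hc0 : ∑ x ∈ S, c x = 0) (hc1 : ∑ x ∈ S, c x * x = 0) :
    ∃ p : ℝ[X], (p = 0 ∨ p.natDegree + 3 ≤ 2 * N) ∧
      (∀ x ∈ S, c x = nodalWeight S id x * p.eval x) ∧
      ∀ y, y ∉ S → p.eval y = (∏ x ∈ S, (y - x)) * ∑ x ∈ S, c x / (y - x) := by
  set p := interpolate S id fun x => c x / nodalWeight S id x with hp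
  set r := interpolate S id fun x => (c x * x ^ 2) / nodalWeight S id x with hr
  refine ⟨p, ?_, ?_, fun y hy => eval_interpolate_div_nodalWeight S c hy⟩
  · have hpr : X ^ 2 * p = r := by
      refine eq_of_infinite_eval_eq _ _ (S.finite_toSet.infinite_compl.mono fun y hy => ?_)
      have hy' : y ∉ S := by simpa using hy
      have hsum : y ^ 2 * ∑ x ∈ S, c x / (y - x) = ∑ x ∈ S, c x * x ^ 2 / (y - x) := by
        have : ∑ x ∈ S, c x * x ^ 2 / (y - x) =
            y ^ 2 * ∑ x ∈ S, c x / (y - x) - (y * ∑ x ∈ S, c x + ∑ x ∈ S, c x * x) := by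
          rw [Finset.mul_sum, Finset.mul_sum, ← Finset.sum_add_distrib, ← Finset.sum_sub_distrib]
          refine Finset.sum_congr rfl fun x hx => ?_
          have : y - x ≠ 0 := sub_ne_zero.mpr fun h => hy' (h ▸ hx)
          field_simp
          ring
        rw [this, hc0, hc1]; ring
      simp only [Set.mem_ofPred_eq, eval_mul, eval_pow, eval_X]
      rw [hp, hr, eval_interpolate_div_nodalWeight S c hy',
        eval_interpolate_div_nodalWeight S (fun x => c x * x ^ 2) hy', ← hsum]
      ring
    by_cases hp0 : p = 0
    · exact Or.inl hp0
    right
    have h1 : r.degree < S.card := degree_interpolate_lt _ Function.injective_id.injOn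
    have hr0 : r ≠ 0 := by rw [← hpr]; exact mul_ne_zero (pow_ne_zero _ X_ne_zero) hp0
    rw [degree_eq_natDegree hr0, hS, ← hpr, (monic_X_pow 2).natDegree_mul' hp0,
      natDegree_X_pow] at h1
    have : 2 + p.natDegree < 2 * N := by exact_mod_cast h1
    omega
  · intro x hx
    have h1 := nodalWeight_ne_zero (v := id) (s := S) Function.injective_id.injOn hx
    have h2 : p.eval x = c x / nodalWeight S id x :=
      eval_interpolate_at_node (v := id) _ Function.injective_id.injOn hx
    rw [h2]
    field_simp

/-- The Jensen inequality for signed measures with at most `2 N` atoms. -/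
theorem DividedDifferenceConvex.sum_nonneg {N : ℕ} {h : ℝ → ℝ} (hh : DividedDifferenceConvex N h)
    {S : Finset ℝ} (hpos : ∀ x ∈ S, 0 < x) (hS : S.card = 2 * N) {c : ℝ → ℝ}
    (hc0 : ∑ x ∈ S, c x = 0) (hc1 : ∑ x ∈ S, c x * x = 0)
    (hleft : ∀ y, (∀ x ∈ S, y < x) → 0 ≤ ∑ x ∈ S, c x / (x - y))
    (hright : ∀ y, (∀ x ∈ S, x < y) → 0 ≤ ∑ x ∈ S, c x / (y - x)) :
    0 ≤ ∑ x ∈ S, c x * h x := by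
  obtain ⟨p, hpdeg, hpc, hpeval⟩ := exists_polynomial_of_sum_eq_zero hS hc0 hc1
  have hsum : ∑ x ∈ S, c x * h x = ∑ x ∈ S, nodalWeight S id x * (p.eval x * h x) :=
    Finset.sum_congr rfl fun x hx => by rw [hpc x hx, mul_assoc]
  rw [hsum]
  rcases hpdeg with rfl | hpdeg
  · simp
  obtain ⟨m, rfl⟩ : ∃ m, N = m + 2 := ⟨N - 2, by omega⟩
  have hne : S.Nonempty := Finset.card_pos.mp (by omega)
  set a := S.min' hne
  set b := S.max' hne
  have haS : a ∈ S := S.min'_mem hne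
  have hbS : b ∈ S := S.max'_mem hne
  have hab : a < b := Finset.min'_lt_max'_of_card S (by omega)
  have hmem : p ∈ oddCone a b m := by
    refine mem_oddCone hab (by omega) (fun t ht => ?_) fun t ht => ?_
    · have hlt : ∀ x ∈ S, t < x := fun x hx => ht.trans_le (S.min'_le x hx)
      rw [hpeval t fun h => (hlt t h).false]
      have h1 : ∏ x ∈ S, (t - x) = ∏ x ∈ S, (x - t) := by
        have : ∏ x ∈ S, (t - x) = ∏ x ∈ S, (-1) * (x - t) :=
          Finset.prod_congr rfl fun x _ => by ring
        rw [this, Finset.prod_mul_distrib, Finset.prod_const, hS, pow_mul]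
        simp
      have h2 : ∑ x ∈ S, c x / (t - x) = -∑ x ∈ S, c x / (x - t) := by
        rw [← Finset.sum_neg_distrib]
        refine Finset.sum_congr rfl fun x _ => ?_
        rw [← neg_sub x t, div_neg]
      rw [h1, h2]
      have h3 : 0 ≤ ∏ x ∈ S, (x - t) :=
        Finset.prod_nonneg fun x hx => sub_nonneg.mpr (hlt x hx).le
      nlinarith [mul_nonneg h3 (hleft t hlt)]
    · have hlt : ∀ x ∈ S, x < t := fun x hx => (S.le_max' x hx).trans_lt ht
      rw [hpeval t fun h => (hlt t h).false]
      exact mul_nonneg (Finset.prod_nonneg fun x hx => sub_nonneg.mpr (hlt x hx).le)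
        (hright t hlt)
  have key : ∀ d ∈ S, ∀ q : ℝ[X], q.natDegree ≤ m →
      0 ≤ ∑ x ∈ S, nodalWeight S id x * (((X - C d) * q ^ 2).eval x * h x) := by
    intro d hd q hq
    have := sum_nodalWeight_linear_mul hd fun x => q.eval x ^ 2 * h x
    simp only [eval_mul, eval_sub, eval_X, eval_C, eval_pow, mul_assoc] at this ⊢
    rw [this]
    refine hh _ (fun y hy => hpos y (Finset.mem_of_mem_erase hy)) ?_ q (by omega)
    rw [Finset.card_erase_of_mem hd]; omega
  clear hpc hpeval hsum hpdeg
  induction hmem using AddSubmonoid.closure_induction with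
  | mem x hx =>
    obtain ⟨q, hq, rfl | rfl⟩ := hx
    · exact key a haS q hq
    · exact key b hbS q hq
  | zero => simp
  | add x y _ _ hx hy =>
    simp only [eval_add, add_mul, mul_add, Finset.sum_add_distrib]
    exact add_nonneg hx hy

end DividedDifferences

section LimitsOfNodes

open Polynomial Lagrange Filter Topology

/-- Nonnegativity of the divided differences of `q² f` over `2 N` positive nodes, for all
polynomials `q` of degree less than `N`. -/
def DividedDifferenceMonotone (N : ℕ) (f : ℝ → ℝ) : Prop :=
  ∀ Y : Finset ℝ, (∀ y ∈ Y, 0 < y) → Y.card = 2 * N → ∀ q : ℝ[X], q.natDegree < N →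
    0 ≤ ∑ y ∈ Y, nodalWeight Y id y * (q.eval y ^ 2 * f y)

theorem sum_nodalWeight_insert {Y : Finset ℝ} {y : ℝ} (hy : y ∉ Y) (F : ℝ → ℝ) :
    ∑ x ∈ insert y Y, nodalWeight (insert y Y) id x * F x =
      (∏ x ∈ Y, (y - x))⁻¹ * F y + ∑ x ∈ Y, nodalWeight Y id x / (x - y) * F x := by
  rw [Finset.sum_insert hy]
  congr 1
  · simp [nodalWeight, Finset.erase_insert hy]
  · refine Finset.sum_congr rfl fun x hx => ?_
    have hxy : x ≠ y := fun h => hy (h ▸ hx)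
    have h1 := nodalWeight_mul_sub_eq_erase (Finset.mem_insert_self y Y) hxy
    rw [Finset.erase_insert hy] at h1
    rw [← h1, mul_div_cancel_right₀ _ (sub_ne_zero.mpr hxy)]

theorem DividedDifferenceMonotone.neg_convex {N : ℕ} {g : ℝ → ℝ}
    (hg : DividedDifferenceMonotone N g) (hg0 : ∀ t, 0 < t → 0 ≤ g t) {K : ℝ}
    (hK : ∀ t, 1 ≤ t → g t ≤ K * t) : DividedDifferenceConvex N fun t => -g t := by
  intro Y hY hcard u hu
  have hev : ∀ᶠ y : ℝ in atTop, 1 ≤ y ∧ ∀ x ∈ Y, x < y :=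
    (eventually_ge_atTop 1).and ((eventually_all_finset Y).mpr fun x _ => eventually_gt_atTop x)
  have h0 : ∀ᶠ y : ℝ in atTop, 0 ≤ y * (u.eval y ^ 2 * g y) / (∏ x ∈ Y, (y - x)) +
      ∑ x ∈ Y, y / (x - y) * (nodalWeight Y id x * (u.eval x ^ 2 * g x)) := by
    filter_upwards [hev] with y hy
    have hyY : y ∉ Y := fun h => (hy.2 y h).false
    have h1 := hg (insert y Y) (fun x hx => by
      rcases Finset.mem_insert.mp hx with rfl | hx
      · linarith [hy.1]
      · exact hY x hx) (by rw [Finset.card_insert_of_notMem hyY]; exact hcard) u (by omega)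
    rw [sum_nodalWeight_insert hyY fun x => u.eval x ^ 2 * g x] at h1
    have h2 := mul_nonneg (show 0 ≤ y by linarith [hy.1]) h1
    rw [mul_add, Finset.mul_sum] at h2
    refine h2.trans_eq ?_
    congr 1
    · rw [div_eq_mul_inv]; ring
    · exact Finset.sum_congr rfl fun x _ => by ring
  have hlim1 : Tendsto (fun y : ℝ => y * (u.eval y ^ 2 * g y) / (∏ x ∈ Y, (y - x))) atTop
      (𝓝 0) := by
    have hz : Tendsto (fun y : ℝ => K * ((X ^ 2 * u ^ 2 : ℝ[X]).eval y / (nodal Y id).eval y))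
        atTop (𝓝 (K * 0)) := by
      refine (div_tendsto_atTop_zero_of_degree_lt _ _ ?_).const_mul K
      rw [degree_nodal]
      refine (degree_le_natDegree).trans_lt ?_
      have h3 : (X ^ 2 * u ^ 2 : ℝ[X]).natDegree ≤ 2 + 2 * u.natDegree :=
        natDegree_mul_le.trans (add_le_add (natDegree_X_pow_le 2) natDegree_pow_le)
      exact_mod_cast h3.trans_lt (by omega)
    rw [mul_zero] at hz
    refine tendsto_of_tendsto_of_tendsto_of_le_of_le' tendsto_const_nhds hz ?_ ?_
    · filter_upwards [hev] with y hy
      have h3 : 0 ≤ ∏ x ∈ Y, (y - x) := Finset.prod_nonneg fun x hx => by linarith [hy.2 x hx]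
      have h4 := hg0 y (by linarith [hy.1])
      have h5 : 0 ≤ y := by linarith [hy.1]
      positivity
    · filter_upwards [hev] with y hy
      have h3 : 0 ≤ ∏ x ∈ Y, (y - x) := Finset.prod_nonneg fun x hx => by linarith [hy.2 x hx]
      have h4 := hK y hy.1
      have h5 : 0 ≤ y := by linarith [hy.1]
      rw [← mul_div_assoc, eval_nodal]
      refine div_le_div_of_nonneg_right ?_ h3
      simp only [eval_mul, eval_pow, eval_X]
      calc y * (u.eval y ^ 2 * g y) ≤ y * (u.eval y ^ 2 * (K * y)) := by gcongr
        _ = _ := by ring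
  have hlim2 : Tendsto (fun y : ℝ => ∑ x ∈ Y, y / (x - y) *
      (nodalWeight Y id x * (u.eval x ^ 2 * g x))) atTop
      (𝓝 (∑ x ∈ Y, (-1) * (nodalWeight Y id x * (u.eval x ^ 2 * g x)))) := by
    refine tendsto_finsetSum _ fun x hx => Tendsto.mul_const _ ?_
    have h3 := div_tendsto_atTop_leadingCoeff_div_of_degree_eq (X : ℝ[X]) (C x - X) (by
      rw [← neg_sub, degree_neg, degree_X_sub_C, degree_X])
    have h4 : (C x - X : ℝ[X]).leadingCoeff = -1 := by
      rw [← neg_sub, leadingCoeff_neg, leadingCoeff_X_sub_C]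
    rw [h4] at h3
    simpa using h3
  have h := ge_of_tendsto (hlim1.add hlim2) h0
  rw [zero_add] at h
  exact h.trans_eq (Finset.sum_congr rfl fun x _ => by ring)

theorem DividedDifferenceMonotone.mul_self_convex {N : ℕ} {f : ℝ → ℝ}
    (hf : DividedDifferenceMonotone N f) {K : ℝ} (hK : ∀ t, 0 < t → t < 1 → |f t| ≤ K) :
    DividedDifferenceConvex N fun t => t * f t := by
  intro Y hY hcard u hu
  have hev : ∀ᶠ y : ℝ in 𝓝[>] 0, 0 < y ∧ y < 1 ∧ ∀ x ∈ Y, y < x := by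
    refine (eventually_mem_nhdsWithin).and (Eventually.filter_mono nhdsWithin_le_nhds ?_)
    exact (eventually_lt_nhds one_pos).and
      ((eventually_all_finset Y).mpr fun x hx => eventually_lt_nhds (hY x hx))
  have h0 : ∀ᶠ y : ℝ in 𝓝[>] 0, 0 ≤ (∏ x ∈ Y, (y - x))⁻¹ * (y * u.eval y) ^ 2 * f y +
      ∑ x ∈ Y, nodalWeight Y id x / (x - y) * ((x * u.eval x) ^ 2 * f x) := by
    filter_upwards [hev] with y hy
    have hyY : y ∉ Y := fun h => (hy.2.2 y h).false
    have h1 := hf (insert y Y) (fun x hx => by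
      rcases Finset.mem_insert.mp hx with rfl | hx
      · exact hy.1
      · exact hY x hx) (by rw [Finset.card_insert_of_notMem hyY]; exact hcard) (X * u)
      (natDegree_mul_le.trans_lt (by rw [natDegree_X]; omega))
    rw [sum_nodalWeight_insert hyY fun x => (X * u : ℝ[X]).eval x ^ 2 * f x] at h1
    simp only [eval_mul, eval_X, ← mul_assoc] at h1 ⊢
    exact h1
  have hlim1 : Tendsto (fun y : ℝ => (∏ x ∈ Y, (y - x))⁻¹ * (y * u.eval y) ^ 2 * f y) (𝓝[>] 0)
      (𝓝 0) := by
    have h3 : Tendsto (fun y : ℝ => (∏ x ∈ Y, (y - x))⁻¹ * (y * u.eval y) ^ 2) (𝓝[>] 0)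
        (𝓝 0) := by
      have h4 : ContinuousAt (fun y : ℝ => (∏ x ∈ Y, (y - x))⁻¹ * (y * u.eval y) ^ 2) 0 := by
        refine ContinuousAt.mul (ContinuousAt.inv₀ (by fun_prop) ?_) (by fun_prop)
        exact Finset.prod_ne_zero_iff.mpr fun x hx => by
          have := hY x hx
          simpa using this.ne'
      have h5 := h4.tendsto
      simp only [zero_mul, ne_eq, OfNat.ofNat_ne_zero, not_false_eq_true, zero_pow, mul_zero] at h5
      exact h5.mono_left nhdsWithin_le_nhds
    refine h3.zero_mul_isBoundedUnder_le ⟨K, ?_⟩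
    rw [eventually_map]
    filter_upwards [hev] with y hy
    exact hK y hy.1 hy.2.1
  have hlim2 : Tendsto (fun y : ℝ => ∑ x ∈ Y, nodalWeight Y id x / (x - y) *
      ((x * u.eval x) ^ 2 * f x)) (𝓝[>] 0)
      (𝓝 (∑ x ∈ Y, nodalWeight Y id x / (x - 0) * ((x * u.eval x) ^ 2 * f x))) := by
    refine tendsto_finsetSum _ fun x hx => Tendsto.mul_const _ ?_
    have h3 : ContinuousAt (fun y : ℝ => nodalWeight Y id x / (x - y)) 0 :=
      ContinuousAt.div (by fun_prop) (by fun_prop) (by simpa using (hY x hx).ne')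
    exact h3.tendsto.mono_left nhdsWithin_le_nhds
  have h := ge_of_tendsto (hlim1.add hlim2) h0
  rw [zero_add] at h
  refine h.trans_eq (Finset.sum_congr rfl fun x hx => ?_)
  have := (hY x hx).ne'
  rw [sub_zero]
  field_simp

end LimitsOfNodes

section FunctionalCalculus

open Polynomial Set

theorem exists_spectrum_subset_Icc {A : H →L[ℂ] H} (hA : 0 ≤ A) (hAu : IsUnit A) :
    ∃ a b : ℝ, 0 < a ∧ spectrum ℝ A ⊆ Icc a b := by
  have hc : IsCompact (spectrum ℝ A) := spectrum.isCompact A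
  have hpos : ∀ x ∈ spectrum ℝ A, 0 < x := fun x hx =>
    (spectrum_nonneg_of_nonneg hA hx).lt_of_ne fun h => spectrum.zero_notMem ℝ hAu (h ▸ hx)
  rcases (spectrum ℝ A).eq_empty_or_nonempty with h | h
  · exact ⟨1, 1, one_pos, by simp [h]⟩
  · obtain ⟨a, ha, hmin⟩ := hc.exists_isLeast h
    obtain ⟨b, _, hmax⟩ := hc.exists_isGreatest h
    exact ⟨a, b, hpos a ha, fun x hx => ⟨hmin hx, hmax hx⟩⟩

theorem spectrum_subset_Icc_iff {A : H →L[ℂ] H} (hA : IsSelfAdjoint A) {a b : ℝ} :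
    spectrum ℝ A ⊆ Icc a b ↔
      algebraMap ℝ (H →L[ℂ] H) a ≤ A ∧ A ≤ algebraMap ℝ (H →L[ℂ] H) b := by
  rw [algebraMap_le_iff_le_spectrum (ha := hA), le_algebraMap_iff_spectrum_le (ha := hA)]
  exact ⟨fun h => ⟨fun x hx => (h hx).1, fun x hx => (h hx).2⟩, fun h x hx => ⟨h.1 x hx, h.2 x hx⟩⟩

theorem isUnit_of_algebraMap_le {A : H →L[ℂ] H} (hA : IsSelfAdjoint A) {a : ℝ} (ha : 0 < a)
    (h : algebraMap ℝ (H →L[ℂ] H) a ≤ A) : IsUnit A := by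
  refine spectrum.isUnit_of_zero_notMem ℝ fun h0 => ?_
  exact ha.not_ge ((algebraMap_le_iff_le_spectrum (ha := hA)).mp h 0 h0)

theorem exists_polynomial_norm_sub_cfc_le {A : H →L[ℂ] H} (hA : IsSelfAdjoint A) {a b : ℝ}
    (hs : spectrum ℝ A ⊆ Icc a b) {f : ℝ → ℝ} (hf : ContinuousOn f (Icc a b)) {ε : ℝ}
    (hε : 0 < ε) :
    ∃ p : ℝ[X], (∀ t ∈ Icc a b, |p.eval t - f t| < ε) ∧ ‖aeval A p - cfc f A‖ ≤ ε := by
  obtain ⟨p, hp⟩ := exists_polynomial_near_of_continuousOn a b f hf ε hε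
  refine ⟨p, hp, ?_⟩
  rw [← cfc_polynomial p A, ← cfc_sub _ _ A p.continuous.continuousOn (hf.mono hs)]
  exact norm_cfc_le hε.le fun x hx => (hp x (hs hx)).le

theorem aeval_apply_of_apply_eq_smul {A : H →L[ℂ] H} {w : H} {c : ℝ} (hw : A w = (c : ℂ) • w)
    (p : ℝ[X]) : aeval A p w = ((p.eval c : ℝ) : ℂ) • w := by
  induction p using Polynomial.induction_on' with
  | add p q hp hq => simp [hp, hq, add_smul]
  | monomial n r =>
    have h : ∀ n : ℕ, (A ^ n) w = ((c : ℂ) ^ n) • w := by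
      intro n
      induction n with
      | zero => simp
      | succ n ih => rw [pow_succ', mul_apply_eq_comp, ih, map_smul, hw, smul_smul,
          pow_succ]
    rw [aeval_monomial, mul_apply_eq_comp, h, eval_monomial, map_smul,
      Algebra.algebraMap_eq_smul_one]
    rw [smul_apply, one_apply_eq_self, ← Complex.coe_smul r w, smul_smul, Complex.ofReal_mul,
      Complex.ofReal_pow, mul_comm]

theorem mem_spectrum_of_apply_eq_smul {A : H →L[ℂ] H} {w : H} (hw0 : w ≠ 0) {c : ℝ}
    (hw : A w = (c : ℂ) • w) : c ∈ spectrum ℝ A := by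
  rw [spectrum.mem_iff]
  rintro ⟨u, hu⟩
  have h1 : (u : H →L[ℂ] H) w = 0 := by
    rw [hu, sub_apply, hw, Algebra.algebraMap_eq_smul_one]
    simp
  have h2 : ((u⁻¹ : (H →L[ℂ] H)ˣ) : H →L[ℂ] H) ((u : H →L[ℂ] H) w) = w := by
    rw [← mul_apply_eq_comp, Units.inv_mul, one_apply_eq_self]
  rw [h1, map_zero] at h2
  exact hw0 h2.symm

/-- The functional calculus acts on eigenvectors by evaluation at the eigenvalue. -/
theorem cfc_apply_of_apply_eq_smul {A : H →L[ℂ] H} (hA : 0 ≤ A) (hAu : IsUnit A) {f : ℝ → ℝ}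
    (hf : ContinuousOn f (Ioi 0)) {w : H} {c : ℝ} (hw : A w = (c : ℂ) • w) :
    cfc f A w = ((f c : ℝ) : ℂ) • w := by
  rcases eq_or_ne w 0 with rfl | hw0
  · simp
  obtain ⟨a, b, ha, hs⟩ := exists_spectrum_subset_Icc hA hAu
  have hc := hs (mem_spectrum_of_apply_eq_smul hw0 hw)
  rw [← sub_eq_zero, ← norm_le_zero_iff]
  refine le_of_forall_pos_le_add fun ε hε => ?_
  have hδ : 0 < ε / (2 * ‖w‖) := by positivity
  obtain ⟨p, hp, hn⟩ := exists_polynomial_norm_sub_cfc_le hA.isSelfAdjoint hs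
    (hf.mono fun x hx => ha.trans_le hx.1) hδ
  have h1 : cfc f A w - ((f c : ℝ) : ℂ) • w =
      -((aeval A p - cfc f A) w) + ((p.eval c - f c : ℝ) : ℂ) • w := by
    rw [sub_apply, aeval_apply_of_apply_eq_smul hw, Complex.ofReal_sub,
      sub_smul]
    abel
  have h2 : ‖(aeval A p - cfc f A) w‖ ≤ ε / (2 * ‖w‖) * ‖w‖ :=
    ((aeval A p - cfc f A).le_opNorm w).trans (by gcongr)
  have h3 : ‖((p.eval c - f c : ℝ) : ℂ) • w‖ ≤ ε / (2 * ‖w‖) * ‖w‖ := by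
    rw [norm_smul, Complex.norm_real, Real.norm_eq_abs]
    gcongr
    exact (hp c hc).le
  have h4 : ε / (2 * ‖w‖) * ‖w‖ = ε / 2 := by
    have := norm_pos_iff.mpr hw0
    field_simp
  rw [h1]
  refine (norm_add_le _ _).trans ?_
  rw [norm_neg]
  linarith

theorem re_inner_mono {A B : H →L[ℂ] H} (h : A ≤ B) (x : H) :
    (inner ℂ x (A x)).re ≤ (inner ℂ x (B x)).re := by
  have := ((ContinuousLinearMap.le_def A B).mp h).re_inner_nonneg_right x
  simpa [inner_sub_right] using this

theorem le_of_re_inner_le {A B : H →L[ℂ] H} (hA : IsSelfAdjoint A) (hB : IsSelfAdjoint B)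
    (h : ∀ x, (inner ℂ x (A x)).re ≤ (inner ℂ x (B x)).re) : A ≤ B := by
  rw [ContinuousLinearMap.le_def, ContinuousLinearMap.isPositive_def']
  refine ⟨hB.sub hA, fun x => ?_⟩
  rw [ContinuousLinearMap.reApplyInnerSelf_apply, inner_re_symm]
  simpa [inner_sub_right] using h x

end FunctionalCalculus

section Interlacing

open Polynomial Lagrange

theorem exists_interlacing {N : ℕ} {Y : Finset ℝ} (hY : Y.card = 2 * N) :
    ∃ p q : Fin N → ℝ, (∀ i, p i ∈ Y) ∧ (∀ i, q i ∈ Y) ∧ (∀ i, p i < q i) ∧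
      (∀ i k, i < k → q i < p k) ∧ (∀ F : ℝ → ℝ, ∑ y ∈ Y, F y = ∑ i, F (p i) + ∑ i, F (q i)) ∧
      ∀ F : ℝ → ℝ[X], ∏ y ∈ Y, F y = (∏ i, F (p i)) * ∏ i, F (q i) := by
  have hc : Y.card = N * 2 := by omega
  set e := Y.orderEmbOfFin hc
  have hval : ∀ (i : Fin N) (j : Fin 2), (finProdFinEquiv (i, j)).val = j + 2 * i :=
    fun i j => rfl
  refine ⟨fun i => e (finProdFinEquiv (i, 0)), fun i => e (finProdFinEquiv (i, 1)),
    fun i => Y.orderEmbOfFin_mem hc _, fun i => Y.orderEmbOfFin_mem hc _, fun i => ?_,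
    fun i k hik => ?_, fun F => ?_, fun F => ?_⟩
  · refine e.strictMono (Fin.lt_def.mpr ?_)
    simp [hval]
  · refine e.strictMono (Fin.lt_def.mpr ?_)
    have := Fin.lt_def.mp hik
    simp only [hval, Fin.val_one, Fin.val_zero]
    omega
  · rw [← Finset.sum_add_distrib]
    have h1 : ∑ y ∈ Y, F y = ∑ k, F (e k) := by
      conv_lhs => rw [← Finset.map_orderEmbOfFin_univ Y hc, Finset.sum_map]
      rfl
    rw [h1, ← finProdFinEquiv.sum_comp, Fintype.sum_prod_type]
    simp
  · rw [← Finset.prod_mul_distrib]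
    have h1 : ∏ y ∈ Y, F y = ∏ k, F (e k) := by
      conv_lhs => rw [← Finset.map_orderEmbOfFin_univ Y hc, Finset.prod_map]
      rfl
    rw [h1, ← finProdFinEquiv.prod_comp, Fintype.prod_prod_type]
    simp

theorem eval_eq_eval_nodal_mul_sum {N : ℕ} {p : Fin N → ℝ} (hp : Function.Injective p)
    {r : ℝ[X]} (hr : r.degree < N) {z : ℝ} (hz : ∀ i, z ≠ p i) :
    r.eval z = (nodal Finset.univ p).eval z *
      ∑ i, nodalWeight Finset.univ p i * r.eval (p i) / (z - p i) := by
  conv_lhs => rw [eq_interpolate (s := Finset.univ) (v := p) (f := r) hp.injOn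
    (by simpa using hr)]
  rw [eval_interpolate_not_at_node _ fun i _ => hz i]
  refine congrArg _ (Finset.sum_congr rfl fun i _ => ?_)
  rw [div_eq_mul_inv]
  ring

theorem neg_eval_nodal_mul_nodalWeight_nonneg {N : ℕ} {p q : Fin N → ℝ} (hpq : ∀ i, p i < q i)
    (hqp : ∀ i k, i < k → q i < p k) (i : Fin N) :
    0 ≤ -((nodal Finset.univ q).eval (p i) * nodalWeight Finset.univ p i) := by
  rw [eval_nodal, nodalWeight, ← Finset.mul_prod_erase _ _ (Finset.mem_univ i), mul_assoc,
    ← Finset.prod_mul_distrib, ← neg_mul, neg_sub]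
  refine mul_nonneg (sub_nonneg.mpr (hpq i).le) (Finset.prod_nonneg fun k hk => ?_)
  rcases lt_or_gt_of_ne (Finset.ne_of_mem_erase hk) with h | h
  · have h1 := hqp k i h
    have h2 := hpq k
    exact mul_nonneg (by linarith) (inv_nonneg.mpr (by linarith))
  · have h1 := hqp i k h
    have h2 := hpq k
    have h3 := hpq i
    exact mul_nonneg_of_nonpos_of_nonpos (by linarith) (inv_nonpos.mpr (by linarith))

theorem strictMono_of_interlacing {N : ℕ} {p q : Fin N → ℝ} (hpq : ∀ i, p i < q i)
    (hqp : ∀ i k, i < k → q i < p k) : StrictMono p ∧ StrictMono q ∧ ∀ i j, q j ≠ p i := by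
  refine ⟨fun i k h => (hpq i).trans (hqp i k h), fun i k h => (hqp i k h).trans (hpq k),
    fun i j => ?_⟩
  rcases lt_trichotomy i j with h | rfl | h
  · exact ((hpq i).trans ((hqp i j h).trans (hpq j))).ne'
  · exact (hpq i).ne'
  · exact (hqp j i h).ne

theorem nodalWeight_of_nodal_eq_mul {N : ℕ} {Y : Finset ℝ} {p : Fin N → ℝ} {b : ℝ[X]}
    (h : nodal Y id = nodal Finset.univ p * b) (i : Fin N) (hi : p i ∈ Y) :
    nodalWeight Y id (p i) = nodalWeight Finset.univ p i / b.eval (p i) := by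
  rw [nodalWeight_eq_eval_derivative_nodal hi,
    nodalWeight_eq_eval_derivative_nodal (Finset.mem_univ i), h, derivative_mul, eval_add,
    eval_mul, eval_mul, id, eval_nodal_at_node (Finset.mem_univ i), zero_mul, add_zero, mul_inv,
    div_eq_mul_inv]

/-- The scalar identities behind the rank one perturbation with prescribed interlacing spectra. -/
theorem exists_rankOne_data {N : ℕ} {p q : Fin N → ℝ} (hpq : ∀ i, p i < q i)
    (hqp : ∀ i k, i < k → q i < p k) {r : ℝ[X]} (hr : r.natDegree < N) :
    ∃ v y c : Fin N → ℝ, (∀ j, ∑ i, v i * (v i / (q j - p i)) = 1) ∧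
      (∀ i, y i = ∑ j, c j * (v i / (q j - p i))) ∧
      (∀ j, c j * ∑ i, y i * (v i / (q j - p i)) =
        nodalWeight Finset.univ q j / (nodal Finset.univ p).eval (q j) * r.eval (q j) ^ 2) ∧
      ∀ i, y i * y i =
        -(nodalWeight Finset.univ p i / (nodal Finset.univ q).eval (p i) * r.eval (p i) ^ 2) := by
  obtain ⟨hp, hq, hne⟩ := strictMono_of_interlacing hpq hqp
  set a := nodal Finset.univ p
  set b := nodal Finset.univ q
  have hav : ∀ j, a.eval (q j) ≠ 0 := fun j => eval_nodal_not_at_node fun i _ => hne i j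
  have hbv : ∀ i, b.eval (p i) ≠ 0 := fun i => eval_nodal_not_at_node fun j _ => (hne i j).symm
  have hrd : r.degree < N := degree_le_natDegree.trans_lt (by exact_mod_cast hr)
  have hsub : ∀ i j, q j - p i ≠ 0 := fun i j => sub_ne_zero.mpr (hne i j)
  set v : Fin N → ℝ := fun i => √(-(b.eval (p i) * nodalWeight Finset.univ p i)) with hv
  have hv2 : ∀ i, v i * v i = -(b.eval (p i) * nodalWeight Finset.univ p i) := fun i =>
    Real.mul_self_sqrt (neg_eval_nodal_mul_nodalWeight_nonneg hpq hqp i)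
  refine ⟨v, fun i => -(v i * r.eval (p i) / b.eval (p i)),
    fun j => r.eval (q j) * nodalWeight Finset.univ q j, fun j => ?_, fun i => ?_, fun j => ?_,
    fun i => ?_⟩
  · have hba : (b - a).degree < N := by
      have h1 : b.degree = N := by simp [b, degree_nodal]
      have h2 : a.degree = N := by simp [a, degree_nodal]
      rw [← h1]
      exact degree_sub_lt_left (h1.trans h2.symm) nodal_ne_zero
        (nodal_monic.leadingCoeff.trans nodal_monic.leadingCoeff.symm)
    have h := eval_eq_eval_nodal_mul_sum hp.injective hba fun i => hne i j
    have hbq : b.eval (q j) = 0 := eval_nodal_at_node (Finset.mem_univ j)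
    rw [eval_sub, hbq, zero_sub] at h
    have h3 : ∑ i, nodalWeight Finset.univ p i * (b - a).eval (p i) / (q j - p i) = -1 :=
      mul_left_cancel₀ (hav j) (h.symm.trans (by ring))
    rw [← neg_neg (1 : ℝ), ← h3, ← Finset.sum_neg_distrib]
    refine Finset.sum_congr rfl fun i _ => ?_
    have hap : a.eval (p i) = 0 := eval_nodal_at_node (Finset.mem_univ i)
    rw [mul_div_assoc', hv2, eval_sub, hap]
    ring
  · have h := eval_eq_eval_nodal_mul_sum hq.injective hrd fun j => (hne i j).symm
    beta_reduce
    rw [h, mul_left_comm, mul_div_cancel_left₀ _ (hbv i), Finset.mul_sum,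
      ← Finset.sum_neg_distrib]
    refine Finset.sum_congr rfl fun j _ => ?_
    rw [← neg_sub (q j) (p i)]
    have := hsub i j
    field_simp
  · have h := eval_eq_eval_nodal_mul_sum hp.injective hrd fun i => hne i j
    have h4 : ∑ i, -(v i * r.eval (p i) / b.eval (p i)) * (v i / (q j - p i)) =
        r.eval (q j) / a.eval (q j) := by
      rw [h, mul_div_cancel_left₀ _ (hav j)]
      refine Finset.sum_congr rfl fun i _ => ?_
      have h5 : -(v i * r.eval (p i) / b.eval (p i)) * (v i / (q j - p i)) =
        -((v i * v i) * r.eval (p i) / b.eval (p i) / (q j - p i)) := by ring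
      rw [h5, hv2]
      have := hsub i j
      have := hbv i
      field_simp
    beta_reduce
    rw [h4]
    ring
  · have h5 : -(v i * r.eval (p i) / b.eval (p i)) * -(v i * r.eval (p i) / b.eval (p i)) =
      (v i * v i) * r.eval (p i) ^ 2 / b.eval (p i) ^ 2 := by ring
    beta_reduce
    rw [h5, hv2]
    have := hbv i
    field_simp

end Interlacing

section OperatorMonotone

open Polynomial Lagrange InnerProductSpace

theorem Orthonormal.inner_ofReal_sum {N : ℕ} {e : Fin N → H} (he : Orthonormal ℂ e)
    (a b : Fin N → ℝ) :
    inner ℂ (∑ i, (a i : ℂ) • e i) (∑ i, (b i : ℂ) • e i) = ((∑ i, a i * b i : ℝ) : ℂ) := by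
  rw [he.inner_sum]
  push_cast
  exact Finset.sum_congr rfl fun i _ => by rw [Complex.conj_ofReal]

theorem exists_operator_of_orthonormal {N : ℕ} {e : Fin N → H} (he : Orthonormal ℂ e)
    {p : Fin N → ℝ} (hp : ∀ i, 0 < p i) :
    ∃ P : H →L[ℂ] H, 0 ≤ P ∧ IsUnit P ∧ ∀ i, P (e i) = (p i : ℂ) • e i := by
  obtain ⟨c, hc, hcp⟩ : ∃ c : ℝ, 0 < c ∧ ∀ i, c ≤ p i := by
    rcases isEmpty_or_nonempty (Fin N) with h | h
    · exact ⟨1, one_pos, fun i => (IsEmpty.false i).elim⟩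
    · obtain ⟨i, hi⟩ := Finite.exists_min p
      exact ⟨p i, hp i, hi⟩
  set R : H →L[ℂ] H := ∑ i, ((p i - c : ℝ) : ℂ) • rankOne ℂ (e i) (e i) with hR
  have hR0 : 0 ≤ R := Finset.sum_nonneg fun i _ => by
    rw [ContinuousLinearMap.nonneg_iff_isPositive]
    exact (isPositive_rankOne_self (e i)).smul_of_nonneg
      (by exact_mod_cast sub_nonneg.mpr (hcp i))
  have hle : algebraMap ℝ (H →L[ℂ] H) c ≤ algebraMap ℝ (H →L[ℂ] H) c + R :=
    le_add_of_nonneg_right hR0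
  have hP0 : 0 ≤ algebraMap ℝ (H →L[ℂ] H) c + R :=
    (algebraMap_nonneg (H →L[ℂ] H) hc.le).trans hle
  refine ⟨_, hP0, isUnit_of_algebraMap_le hP0.isSelfAdjoint hc hle, fun k => ?_⟩
  have h1 : R (e k) = ((p k - c : ℝ) : ℂ) • e k := by
    simp only [hR, sum_apply, smul_apply, rankOne_apply, orthonormal_iff_ite.mp he]
    rw [Finset.sum_eq_single k (fun i _ hik => by simp [hik]) (by simp)]
    simp
  rw [add_apply, h1, Algebra.algebraMap_eq_smul_one, smul_apply, one_apply_eq_self,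
    ← Complex.coe_smul c, ← add_smul, ← Complex.ofReal_add]
  congr 2
  ring

/-- Operator monotonicity on a Hilbert space with `N` orthonormal vectors forces positivity of
divided differences over `2 N` nodes. -/
theorem dividedDifferenceMonotone_of_operatorMonotone {N : ℕ} {e : Fin N → H}
    (he : Orthonormal ℂ e) {f : ℝ → ℝ} (hf : ContinuousOn f (Set.Ioi 0))
    (hmono : ∀ A B : H →L[ℂ] H, 0 ≤ A → IsUnit A → A ≤ B → cfc f A ≤ cfc f B) :
    DividedDifferenceMonotone N f := by
  intro Y hY hcard r hr
  obtain ⟨p, q, hpY, hqY, hpq, hqp, hsum, hprod⟩ := exists_interlacing hcard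
  have hnodal : nodal Y id = nodal Finset.univ p * nodal Finset.univ q := by
    simpa only [nodal_eq, id] using hprod fun y => X - C y
  obtain ⟨v, y, c, hv, hy, hc, hyy⟩ := exists_rankOne_data hpq hqp hr
  obtain ⟨-, -, hne⟩ := strictMono_of_interlacing hpq hqp
  obtain ⟨P, hP0, hPu, hP⟩ := exists_operator_of_orthonormal he fun i => hY _ (hpY i)
  set V : H := ∑ i, (v i : ℂ) • e i with hV
  set w : Fin N → H := fun j => ∑ i, ((v i / (q j - p i) : ℝ) : ℂ) • e i with hw
  set u : H := ∑ i, (y i : ℂ) • e i with hu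
  have hR0 : 0 ≤ rankOne ℂ V V :=
    (ContinuousLinearMap.nonneg_iff_isPositive _).mpr (isPositive_rankOne_self V)
  have hle : P ≤ P + rankOne ℂ V V := le_add_of_nonneg_right hR0
  have hQu : IsUnit (P + rankOne ℂ V V) := CStarAlgebra.isUnit_of_le P hle
    ⟨hP0, hPu⟩
  have hQw : ∀ j, (P + rankOne ℂ V V) (w j) = (q j : ℂ) • w j := by
    intro j
    rw [add_apply, rankOne_apply, hV, hw, he.inner_ofReal_sum, hv, map_sum, Complex.ofReal_one,
      one_smul, ← Finset.sum_add_distrib, Finset.smul_sum]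
    refine Finset.sum_congr rfl fun i _ => ?_
    rw [map_smul, hP, smul_smul, smul_smul, ← add_smul, ← Complex.ofReal_mul,
      ← Complex.ofReal_add, ← Complex.ofReal_mul]
    congr 2
    have := sub_ne_zero.mpr (hne i j)
    field_simp
    ring
  have huw : u = ∑ j, (c j : ℂ) • w j := by
    simp only [hu, hw, Finset.smul_sum]
    rw [Finset.sum_comm]
    refine Finset.sum_congr rfl fun i _ => ?_
    rw [hy i, Complex.ofReal_sum, Finset.sum_smul]
    exact Finset.sum_congr rfl fun j _ => by rw [smul_smul, ← Complex.ofReal_mul]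
  have hfP : inner ℂ u (cfc f P u) = ((∑ i, f (p i) * (y i * y i) : ℝ) : ℂ) := by
    have : cfc f P u = ∑ i, ((f (p i) * y i : ℝ) : ℂ) • e i := by
      rw [hu, map_sum]
      refine Finset.sum_congr rfl fun i _ => ?_
      rw [map_smul, cfc_apply_of_apply_eq_smul hP0 hPu hf (hP i), smul_smul, ← Complex.ofReal_mul,
        mul_comm]
    rw [this, hu, he.inner_ofReal_sum]
    congr 1
    exact Finset.sum_congr rfl fun i _ => by ring
  have hfQ : inner ℂ u (cfc f (P + rankOne ℂ V V) u) =
      ((∑ j, f (q j) * (c j * ∑ i, y i * (v i / (q j - p i))) : ℝ) : ℂ) := by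
    have : cfc f (P + rankOne ℂ V V) u = ∑ j, ((f (q j) * c j : ℝ) : ℂ) • w j := by
      conv_lhs => rw [huw, map_sum]
      refine Finset.sum_congr rfl fun j _ => ?_
      rw [map_smul, cfc_apply_of_apply_eq_smul (hP0.trans hle) hQu hf (hQw j), smul_smul,
        ← Complex.ofReal_mul, mul_comm]
    rw [this, inner_sum, Complex.ofReal_sum]
    refine Finset.sum_congr rfl fun j _ => ?_
    rw [inner_smul_right, hu, hw, he.inner_ofReal_sum, ← Complex.ofReal_mul, mul_assoc]
  have hfin := re_inner_mono (hmono P _ hP0 hPu hle) u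
  rw [hfP, hfQ, Complex.ofReal_re, Complex.ofReal_re] at hfin
  have h1 : ∑ i, nodalWeight Y id (p i) * (r.eval (p i) ^ 2 * f (p i)) =
      -∑ i, f (p i) * (y i * y i) := by
    rw [← Finset.sum_neg_distrib]
    refine Finset.sum_congr rfl fun i _ => ?_
    rw [hyy, nodalWeight_of_nodal_eq_mul hnodal i (hpY i)]
    ring
  have h2 : ∑ j, nodalWeight Y id (q j) * (r.eval (q j) ^ 2 * f (q j)) =
      ∑ j, f (q j) * (c j * ∑ i, y i * (v i / (q j - p i))) := by
    refine Finset.sum_congr rfl fun j _ => ?_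
    rw [hc, nodalWeight_of_nodal_eq_mul (hnodal.trans (mul_comm _ _)) j (hqY j)]
    ring
  rw [hsum, h1, h2]
  linarith

end OperatorMonotone

/-! ### Operator concave positive functions are operator monotone -/

theorem continuousOn_spectrum {A : H →L[ℂ] H} (hA : 0 ≤ A) (hAu : IsUnit A) {f : ℝ → ℝ}
    (hf : ContinuousOn f (Set.Ioi 0)) : ContinuousOn f (spectrum ℝ A) := by
  obtain ⟨a, b, ha, hs⟩ := exists_spectrum_subset_Icc hA hAu
  exact hf.mono fun t ht => ha.trans_le (hs ht).1

theorem pos_of_mem_spectrum {A : H →L[ℂ] H} (hA : 0 ≤ A) (hAu : IsUnit A) {t : ℝ}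
    (ht : t ∈ spectrum ℝ A) : 0 < t := by
  obtain ⟨a, b, ha, hs⟩ := exists_spectrum_subset_Icc hA hAu
  exact ha.trans_le (hs ht).1

theorem IsOperatorConcaveOn.le_cfc {g : ℝ → ℝ} (hg : IsOperatorConcaveOn H g)
    {A B : H →L[ℂ] H} (hA : 0 ≤ A) (hAu : IsUnit A) (hB : 0 ≤ B) (hBu : IsUnit B) {c : ℝ}
    (hc : c ∈ Set.Icc (0 : ℝ) 1) :
    c • cfc g A + (1 - c) • cfc g B ≤ cfc g (c • A + (1 - c) • B) := by
  have h := hg A B hA hAu hB hBu c hc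
  rw [cfc_neg, cfc_neg, cfc_neg, smul_neg, smul_neg, ← neg_add] at h
  exact neg_le_neg_iff.1 h

theorem IsOperatorConcaveOn.smul_cfc_le {g : ℝ → ℝ} (hg : IsOperatorConcaveOn H g)
    (hg0 : ∀ t, 0 < t → 0 ≤ g t) {A B : H →L[ℂ] H} (hA : 0 ≤ A) (hAu : IsUnit A)
    (hAB : A ≤ B) {c : ℝ} (hc0 : 0 < c) (hc1 : c < 1) :
    c • cfc g A ≤ cfc g (c • B + (1 - c) • (1 : H →L[ℂ] H)) := by
  have h1c : 0 < 1 - c := by linarith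
  have hD : (1 : H →L[ℂ] H) ≤ (c / (1 - c)) • (B - A) + 1 :=
    le_add_of_nonneg_left (smul_nonneg (by positivity) (sub_nonneg.2 hAB))
  have hD0 : (0 : H →L[ℂ] H) ≤ (c / (1 - c)) • (B - A) + 1 := zero_le_one.trans hD
  have hDu : IsUnit ((c / (1 - c)) • (B - A) + 1) :=
    CStarAlgebra.isUnit_of_le 1 hD ⟨zero_le_one, isUnit_one⟩
  have h := hg.le_cfc hA hAu hD0 hDu ⟨hc0.le, hc1.le⟩
  have heq : c • A + (1 - c) • ((c / (1 - c)) • (B - A) + 1) =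
      c • B + (1 - c) • (1 : H →L[ℂ] H) := by
    rw [smul_add, smul_smul, mul_div_cancel₀ _ h1c.ne', smul_sub]
    abel
  rw [heq] at h
  refine le_trans (le_add_of_nonneg_right (smul_nonneg h1c.le ?_)) h
  exact cfc_nonneg fun t ht => hg0 t (pos_of_mem_spectrum hD0 hDu ht)

theorem IsOperatorConcaveOn.cfc_mono {g : ℝ → ℝ} (hg : IsOperatorConcaveOn H g)
    (hgc : ContinuousOn g (Set.Ioi 0)) (hg0 : ∀ t, 0 < t → 0 ≤ g t) {A B : H →L[ℂ] H}
    (hA : 0 ≤ A) (hAu : IsUnit A) (hAB : A ≤ B) : cfc g A ≤ cfc g B := by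
  have hB : 0 ≤ B := hA.trans hAB
  have hBs : IsSelfAdjoint B := .of_nonneg hB
  obtain ⟨a, b, ha, hs⟩ := exists_spectrum_subset_Icc hB (CStarAlgebra.isUnit_of_le A hAB ⟨hA, hAu⟩)
  obtain ⟨h1, h2⟩ := (spectrum_subset_Icc_iff hBs).1 hs
  have hlim : Filter.Tendsto (fun c : ℝ => c • B + (1 - c) • (1 : H →L[ℂ] H))
      (nhdsWithin 1 (Set.Iio 1)) (nhds B) := by
    have : Continuous fun c : ℝ => c • B + (1 - c) • (1 : H →L[ℂ] H) := by fun_prop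
    simpa using (this.tendsto 1).mono_left nhdsWithin_le_nhds
  have hev : ∀ᶠ c : ℝ in nhdsWithin 1 (Set.Iio 1), 0 < c ∧ c < 1 := by
    filter_upwards [Ioo_mem_nhdsLT (zero_lt_one (α := ℝ))] with c hc using hc
  have hsa (c : ℝ) : IsSelfAdjoint (c • B + (1 - c) • (1 : H →L[ℂ] H)) :=
    ((IsSelfAdjoint.all c).smul hBs).add ((IsSelfAdjoint.all (1 - c)).smul (.one _))
  have hsub : ∀ᶠ c : ℝ in nhdsWithin 1 (Set.Iio 1),
      spectrum ℝ (c • B + (1 - c) • (1 : H →L[ℂ] H)) ⊆ Set.Icc (min a 1) (max b 1) := by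
    filter_upwards [hev] with c hc
    rw [spectrum_subset_Icc_iff (hsa c)]
    have hc' : 0 ≤ 1 - c := by linarith
    constructor
    · calc algebraMap ℝ (H →L[ℂ] H) (min a 1)
          = c • algebraMap ℝ _ (min a 1) + (1 - c) • algebraMap ℝ _ (min a 1) := by
            rw [← add_smul]; simp
        _ ≤ c • B + (1 - c) • algebraMap ℝ _ 1 := by
            refine add_le_add (smul_le_smul_of_nonneg_left (le_trans ?_ h1) hc.1.le)
              (smul_le_smul_of_nonneg_left ?_ hc')
            · exact algebraMap_mono _ (min_le_left _ _)
            · exact algebraMap_mono _ (min_le_right _ _)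
        _ = _ := by simp
    · calc c • B + (1 - c) • (1 : H →L[ℂ] H) = c • B + (1 - c) • algebraMap ℝ _ 1 := by simp
        _ ≤ c • algebraMap ℝ _ (max b 1) + (1 - c) • algebraMap ℝ _ (max b 1) := by
            refine add_le_add (smul_le_smul_of_nonneg_left (h2.trans ?_) hc.1.le)
              (smul_le_smul_of_nonneg_left ?_ hc')
            · exact algebraMap_mono _ (le_max_left _ _)
            · exact algebraMap_mono _ (le_max_right _ _)
        _ = algebraMap ℝ (H →L[ℂ] H) (max b 1) := by rw [← add_smul]; simp
  have hcfc := Filter.Tendsto.cfc (isCompact_Icc (a := min a 1) (b := max b 1)) g hlim hsub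
    (.of_forall hsa) (hs.trans (Set.Icc_subset_Icc (min_le_left _ _) (le_max_left _ _))) hBs
    (hgc.mono fun t ht => (lt_min ha one_pos).trans_le ht.1)
  have hleft : Filter.Tendsto (fun c : ℝ => c • cfc g A) (nhdsWithin 1 (Set.Iio 1))
      (nhds (cfc g A)) := by
    have : Continuous fun c : ℝ => c • cfc g A := by fun_prop
    simpa using (this.tendsto 1).mono_left nhdsWithin_le_nhds
  refine le_of_tendsto_of_tendsto hleft hcfc ?_
  filter_upwards [hev] with c hc using hg.smul_cfc_le hg0 hA hAu hAB hc.1 hc.2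

theorem cfc_eq_sqrt_cfc_sq {A : H →L[ℂ] H} (hA : 0 ≤ A) (hAu : IsUnit A) {f : ℝ → ℝ}
    (hf : ContinuousOn f (Set.Ioi 0)) (hf0 : ∀ t, 0 < t → 0 ≤ f t) :
    cfc f A = CFC.sqrt (cfc (fun t => f t ^ 2) A) := by
  have hc := continuousOn_spectrum hA hAu hf
  refine (CFC.sqrt_unique ?_ (cfc_nonneg fun t ht => hf0 t (pos_of_mem_spectrum hA hAu ht))).symm
  rw [← cfc_mul f f A hc hc]
  simp only [sq]

theorem cfc_mono_of_cfc_sq_mono {f : ℝ → ℝ} (hf : ContinuousOn f (Set.Ioi 0))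
    (hf0 : ∀ t, 0 < t → 0 ≤ f t) {A B : H →L[ℂ] H} (hA : 0 ≤ A) (hAu : IsUnit A) (hAB : A ≤ B)
    (h : cfc (fun t => f t ^ 2) A ≤ cfc (fun t => f t ^ 2) B) : cfc f A ≤ cfc f B := by
  rw [cfc_eq_sqrt_cfc_sq hA hAu hf hf0, cfc_eq_sqrt_cfc_sq (hA.trans hAB)
    (CStarAlgebra.isUnit_of_le A hAB ⟨hA, hAu⟩) hf hf0]
  exact CFC.sqrt_le_sqrt _ _ h

theorem one_le_cfc_of_one_le {f : ℝ → ℝ} (hf : ContinuousOn f (Set.Ioi 0))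
    (hf1 : ∀ t, 0 < t → 1 ≤ f t) {A : H →L[ℂ] H} (hA : 0 ≤ A) (hAu : IsUnit A) :
    1 ≤ cfc f A := by
  have hs : IsSelfAdjoint A := .of_nonneg hA
  rw [← cfc_one ℝ A]
  exact _root_.cfc_mono (fun t ht => hf1 t (pos_of_mem_spectrum hA hAu ht)) continuousOn_const
    (continuousOn_spectrum hA hAu hf)

theorem cfc_neg_inv_mono {f : ℝ → ℝ} (hf : ContinuousOn f (Set.Ioi 0))
    (hf1 : ∀ t, 0 < t → 1 ≤ f t) {A B : H →L[ℂ] H} (hA : 0 ≤ A) (hAu : IsUnit A) (hAB : A ≤ B)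
    (h : cfc f A ≤ cfc f B) : cfc (fun t => -(f t)⁻¹) A ≤ cfc (fun t => -(f t)⁻¹) B := by
  have hB := hA.trans hAB
  have hBu := CStarAlgebra.isUnit_of_le A hAB ⟨hA, hAu⟩
  have hinv {C : H →L[ℂ] H} (hC : 0 ≤ C) (hCu : IsUnit C) :
      cfc (fun t => (f t)⁻¹) C = Ring.inverse (cfc f C) := by
    have hs : IsSelfAdjoint C := .of_nonneg hC
    exact cfc_inv f C (fun t ht => (zero_lt_one.trans_le
      (hf1 t (pos_of_mem_spectrum hC hCu ht))).ne') (continuousOn_spectrum hC hCu hf)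
  rw [cfc_neg, cfc_neg, hinv hA hAu, hinv hB hBu, neg_le_neg_iff]
  have h1 := one_le_cfc_of_one_le hf hf1 hA hAu
  exact CStarAlgebra.ringInverse_le_ringInverse h
    ⟨zero_le_one.trans h1, CStarAlgebra.isUnit_of_le 1 h1 ⟨zero_le_one, isUnit_one⟩⟩

theorem algebraMap_le_algebraMap_iff [Nontrivial H] {a b : ℝ} :
    algebraMap ℝ (H →L[ℂ] H) a ≤ algebraMap ℝ (H →L[ℂ] H) b ↔ a ≤ b := by
  refine ⟨fun h => ?_, fun h => algebraMap_mono _ h⟩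
  have := (spectrum_subset_Icc_iff (b := b) (a := a)
    (A := algebraMap ℝ (H →L[ℂ] H) b) (.algebraMap _ (.all b))).2 ⟨h, le_rfl⟩
  exact (this (by simp [spectrum.scalar_eq])).1

theorem isUnit_algebraMap_of_pos {a : ℝ} (ha : 0 < a) : IsUnit (algebraMap ℝ (H →L[ℂ] H) a) :=
  (IsUnit.mk0 a ha.ne').map _

theorem algebraMap_nonneg_of_pos {a : ℝ} (ha : 0 < a) : 0 ≤ algebraMap ℝ (H →L[ℂ] H) a := by
  simpa using algebraMap_mono (H →L[ℂ] H) ha.le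

theorem monotoneOn_of_cfc_mono [Nontrivial H] {f : ℝ → ℝ}
    (h : ∀ A B : H →L[ℂ] H, 0 ≤ A → IsUnit A → A ≤ B → cfc f A ≤ cfc f B) :
    MonotoneOn f (Set.Ioi 0) := by
  intro a ha b _ hab
  have := h _ _ (algebraMap_nonneg_of_pos ha) (isUnit_algebraMap_of_pos ha)
    (algebraMap_mono (H →L[ℂ] H) hab)
  rwa [cfc_algebraMap, cfc_algebraMap, algebraMap_le_algebraMap_iff] at this

theorem IsOperatorConcaveOn.le_linear [Nontrivial H] {g : ℝ → ℝ} (hg : IsOperatorConcaveOn H g)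
    (hg0 : ∀ t, 0 < t → 0 ≤ g t) {t : ℝ} (ht : 1 ≤ t) : g t ≤ 2 * g 1 * t := by
  set c : ℝ := 1 / (2 * t - 1) with hc
  have hpos : 0 < 2 * t - 1 := by linarith
  have hc1 : c ≤ 1 := by rw [hc, div_le_one hpos]; linarith
  have hc0 : 0 < c := by positivity
  have h := hg.le_cfc (algebraMap_nonneg_of_pos (by linarith : 0 < t))
    (isUnit_algebraMap_of_pos (by linarith)) (algebraMap_nonneg_of_pos (by norm_num : (0:ℝ) < 1/2))
    (isUnit_algebraMap_of_pos (by norm_num)) ⟨hc0.le, hc1⟩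
  have hlin (u v : ℝ) : c • algebraMap ℝ (H →L[ℂ] H) u + (1 - c) • algebraMap ℝ (H →L[ℂ] H) v =
      algebraMap ℝ (H →L[ℂ] H) (c * u + (1 - c) * v) := by
    simp only [Algebra.algebraMap_eq_smul_one, smul_smul, add_smul]
  rw [cfc_algebraMap, cfc_algebraMap, hlin, hlin, cfc_algebraMap, algebraMap_le_algebraMap_iff] at h
  have h1 : c * t + (1 - c) * (1 / 2) = 1 := by rw [hc]; field_simp; ring
  rw [h1] at h
  have h2 : c * g t ≤ g 1 := by nlinarith [hg0 (1 / 2) (by norm_num)]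
  have h3 : g t ≤ g 1 * (2 * t - 1) := by
    rw [hc] at h2
    rwa [one_div, inv_mul_le_iff₀ hpos, mul_comm] at h2
  nlinarith [hg0 1 one_pos]

/-! ### Comparison of two finitely supported spectral resolutions -/

section Comparison

theorem two_mul_re_inner_le_of_nonneg {E : H →L[ℂ] H} (hE : 0 ≤ E) (p q : ℝ) (x u : H) :
    2 * (p * q) * (inner ℂ u (E x)).re ≤
      p ^ 2 * (inner ℂ x (E x)).re + q ^ 2 * (inner ℂ u (E u)).re := by
  have h := re_inner_mono hE ((p : ℂ) • x - (q : ℂ) • u)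
  have hsymm : (inner ℂ x (E u)).re = (inner ℂ u (E x)).re := by
    have hs : IsSelfAdjoint E := .of_nonneg hE
    have h1 : inner ℂ (E x) u = inner ℂ x (E u) :=
      ContinuousLinearMap.isSelfAdjoint_iff_isSymmetric.1 hs x u
    rw [← h1]
    exact inner_re_symm (𝕜 := ℂ) (E x) u
  simp only [zero_apply, inner_zero_right, Complex.zero_re, map_sub,
    map_smul, inner_sub_left, inner_sub_right, inner_smul_left, inner_smul_right,
    Complex.conj_ofReal, Complex.sub_re, Complex.re_ofReal_mul, hsymm] at h
  nlinarith [h]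

variable {ι κ : Type*} [Fintype ι] [Fintype κ]

theorem re_inner_sum_smul_apply (E : ι → H →L[ℂ] H) (d : ι → ℝ) (x y : H) :
    (inner ℂ y ((∑ i, d i • E i) x)).re = ∑ i, d i * (inner ℂ y (E i x)).re := by
  simp [Complex.re_sum, ← Complex.coe_smul]

theorem two_mul_re_inner_sub_le {E : ι → H →L[ℂ] H} (hE : ∀ i, 0 ≤ E i) (hE1 : ∑ i, E i = 1)
    {d : ι → ℝ} (hd : ∀ i, 0 < d i) (x u : H) :
    2 * (inner ℂ u x).re - (inner ℂ u ((∑ i, d i • E i) u)).re ≤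
      ∑ i, (inner ℂ x (E i x)).re / d i := by
  have h1 : (inner ℂ u x).re = ∑ i, (inner ℂ u (E i x)).re := by
    simpa [hE1] using re_inner_sum_smul_apply E (fun _ => 1) x u
  rw [h1, re_inner_sum_smul_apply, Finset.mul_sum, ← Finset.sum_sub_distrib]
  refine Finset.sum_le_sum fun i _ => ?_
  have h := two_mul_re_inner_le_of_nonneg (hE i) 1 (d i) x u
  rw [le_div_iff₀ (hd i)]
  nlinarith

/-- The Kadison inequality for a finitely supported resolution of the identity. -/
theorem re_inner_sq_le {E : ι → H →L[ℂ] H} (hE : ∀ i, 0 ≤ E i) (hE1 : ∑ i, E i = 1)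
    (d : ι → ℝ) (x : H) :
    ‖(∑ i, d i • E i) x‖ ^ 2 ≤ ∑ i, (inner ℂ x (E i x)).re * d i ^ 2 := by
  set u := (∑ i, d i • E i) x with hu
  have h1 : ‖u‖ ^ 2 = ∑ i, (inner ℂ u (E i u)).re := by
    rw [← inner_self_eq_norm_sq (𝕜 := ℂ) u]
    simpa [hE1] using re_inner_sum_smul_apply E (fun _ => 1) u u
  have h2 : ‖u‖ ^ 2 = ∑ i, d i * (inner ℂ u (E i x)).re := by
    rw [← inner_self_eq_norm_sq (𝕜 := ℂ) u, ← re_inner_sum_smul_apply, ← hu]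
    rfl
  have h3 : ∑ i, 2 * (d i * (inner ℂ u (E i x)).re) ≤
      ∑ i, ((inner ℂ x (E i x)).re * d i ^ 2 + (inner ℂ u (E i u)).re) :=
    Finset.sum_le_sum fun i _ => by
      have := two_mul_re_inner_le_of_nonneg (hE i) (d i) 1 x u
      linarith
  rw [← Finset.mul_sum, Finset.sum_add_distrib, ← h1, ← h2] at h3
  linarith

variable [DecidableEq κ]

theorem inner_sum_apply_sum_of_diagonal {T : H →L[ℂ] H} {b : κ → H} {τ : κ → ℝ}
    (hT : ∀ j k, inner ℂ (b j) (T (b k)) = if j = k then (τ j : ℂ) else 0) (w : κ → ℂ) :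
    (inner ℂ (∑ j, w j • b j) (T (∑ j, w j • b j))).re = ∑ j, ‖w j‖ ^ 2 * τ j := by
  have : inner ℂ (∑ j, w j • b j) (T (∑ j, w j • b j)) = ((∑ j, ‖w j‖ ^ 2 * τ j : ℝ) : ℂ) := by
    simp only [map_sum, map_smul, sum_inner, inner_sum, inner_smul_left, inner_smul_right, hT,
      mul_ite, mul_zero, Finset.sum_ite_eq', Finset.mem_univ, if_true]
    push_cast
    refine Finset.sum_congr rfl fun j _ => ?_
    rw [← Complex.conj_mul']
    ring
  rw [this, Complex.ofReal_re]

theorem sum_div_le_of_diagonal {E : ι → H →L[ℂ] H} (hE : ∀ i, 0 ≤ E i) (hE1 : ∑ i, E i = 1)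
    {d : ι → ℝ} (hd : ∀ i, 0 < d i) {b : κ → H} (hb : Orthonormal ℂ b) {δ : κ → ℝ}
    (hδ : ∀ j, 0 < δ j)
    (hD : ∀ j k, inner ℂ (b j) ((∑ i, d i • E i) (b k)) = if j = k then (δ j : ℂ) else 0)
    (a : κ → ℂ) {x : H} (hx : x = ∑ j, a j • b j) :
    ∑ j, ‖a j‖ ^ 2 / δ j ≤ ∑ i, (inner ℂ x (E i x)).re / d i := by
  have h := two_mul_re_inner_sub_le hE hE1 hd x (∑ j, (a j / (δ j : ℂ)) • b j)
  rw [inner_sum_apply_sum_of_diagonal hD] at h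
  have h1 : (inner ℂ (∑ j, (a j / (δ j : ℂ)) • b j) x).re = ∑ j, ‖a j‖ ^ 2 / δ j := by
    have : inner ℂ (∑ j, (a j / (δ j : ℂ)) • b j) x = ((∑ j, ‖a j‖ ^ 2 / δ j : ℝ) : ℂ) := by
      rw [hx, hb.inner_sum]
      push_cast
      refine Finset.sum_congr rfl fun j _ => ?_
      rw [← Complex.conj_mul', map_div₀, Complex.conj_ofReal]
      ring
    rw [this, Complex.ofReal_re]
  have h2 : ∑ j, ‖a j / (δ j : ℂ)‖ ^ 2 * δ j = ∑ j, ‖a j‖ ^ 2 / δ j := by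
    refine Finset.sum_congr rfl fun j _ => ?_
    have := (hδ j).ne'
    rw [norm_div, Complex.norm_real, Real.norm_eq_abs, div_pow, sq_abs]
    field_simp
  rw [h1, h2] at h
  linarith

theorem exists_superset_pos_card_eq {S : Finset ℝ} (hS : ∀ x ∈ S, 0 < x) {n : ℕ}
    (hn : S.card ≤ n) : ∃ S' : Finset ℝ, S ⊆ S' ∧ (∀ x ∈ S', 0 < x) ∧ S'.card = n := by
  obtain ⟨t, hSt, ht⟩ := Infinite.exists_superset_card_eq (S.subtype (· ∈ Set.Ioi (0 : ℝ))) n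
    ((Finset.card_subtype _ _).trans_le ((Finset.card_filter_le _ _).trans hn))
  refine ⟨t.map (Function.Embedding.subtype _), fun x hx => ?_, fun x hx => ?_, by simpa using ht⟩
  · exact Finset.mem_map.2 ⟨⟨x, hS x hx⟩, hSt (Finset.mem_subtype.2 hx), rfl⟩
  · obtain ⟨y, -, rfl⟩ := Finset.mem_map.1 hx
    exact y.2

theorem sum_sum_ite_mul {S : Finset ℝ} {p : ι → ℝ} (hp : ∀ i, p i ∈ S) (ν : ι → ℝ) (F : ℝ → ℝ) :
    ∑ x ∈ S, (∑ i, if p i = x then ν i else 0) * F x = ∑ i, ν i * F (p i) := by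
  simp_rw [Finset.sum_mul, ite_mul, zero_mul]
  rw [Finset.sum_comm]
  refine Finset.sum_congr rfl fun i _ => ?_
  rw [Finset.sum_ite_eq S (p i) fun x => ν i * F x, if_pos (hp i)]

/-- A resolution of the identity with barycentre `T` has a larger integral against `h` than
the spectral measure of a compression of `T`. -/
theorem DividedDifferenceConvex.sum_le_sum_of_diagonal {N : ℕ} {h : ℝ → ℝ}
    (hh : DividedDifferenceConvex N h) {E : ι → H →L[ℂ] H} (hE : ∀ i, 0 ≤ E i)
    (hE1 : ∑ i, E i = 1) {p : ι → ℝ} (hp : ∀ i, 0 < p i) {b : κ → H} (hb : Orthonormal ℂ b)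
    {τ : κ → ℝ} (hτ : ∀ j, 0 < τ j)
    (hT : ∀ j k, inner ℂ (b j) ((∑ i, p i • E i) (b k)) = if j = k then (τ j : ℂ) else 0)
    (a : κ → ℂ) {x : H} (hx : x = ∑ j, a j • b j)
    (hN : Fintype.card ι + Fintype.card κ ≤ 2 * N) :
    ∑ j, ‖a j‖ ^ 2 * h (τ j) ≤ ∑ i, (inner ℂ x (E i x)).re * h (p i) := by
  classical
  obtain ⟨S, hS, hSpos, hScard⟩ := exists_superset_pos_card_eq
    (S := Finset.univ.image p ∪ Finset.univ.image τ) (n := 2 * N) (by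
      intro y hy
      rcases Finset.mem_union.1 hy with hy | hy
      · obtain ⟨i, -, rfl⟩ := Finset.mem_image.1 hy
        exact hp i
      · obtain ⟨i, -, rfl⟩ := Finset.mem_image.1 hy
        exact hτ i)
    ((Finset.card_union_le _ _).trans
      ((add_le_add Finset.card_image_le Finset.card_image_le).trans hN))
  have hpS (i) : p i ∈ S := hS (Finset.mem_union_left _ (Finset.mem_image_of_mem _ (by simp)))
  have hτS (j) : τ j ∈ S := hS (Finset.mem_union_right _ (Finset.mem_image_of_mem _ (by simp)))
  have hsum (F : ℝ → ℝ) : ∑ y ∈ S, ((∑ i, if p i = y then (inner ℂ x (E i x)).re else 0) -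
      ∑ j, if τ j = y then ‖a j‖ ^ 2 else 0) * F y =
      ∑ i, (inner ℂ x (E i x)).re * F (p i) - ∑ j, ‖a j‖ ^ 2 * F (τ j) := by
    simp_rw [sub_mul]
    rw [Finset.sum_sub_distrib, sum_sum_ite_mul hpS, sum_sum_ite_mul hτS]
  have hnorm : ∑ j, ‖a j‖ ^ 2 = (inner ℂ x x).re := by
    have : inner ℂ x x = ((∑ j, ‖a j‖ ^ 2 : ℝ) : ℂ) := by
      rw [hx, hb.inner_sum]
      push_cast
      exact Finset.sum_congr rfl fun j _ => Complex.conj_mul' _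
    rw [this, Complex.ofReal_re]
  have hmass : (inner ℂ x x).re = ∑ i, (inner ℂ x (E i x)).re := by
    simpa [hE1] using re_inner_sum_smul_apply E (fun _ => 1) x x
  have key := hh.sum_nonneg (c := fun y => (∑ i, if p i = y then (inner ℂ x (E i x)).re else 0) -
    ∑ j, if τ j = y then ‖a j‖ ^ 2 else 0) hSpos hScard ?_ ?_ ?_ ?_
  · rw [hsum] at key
    linarith
  · have := hsum fun _ => 1
    simp only [mul_one] at this
    rw [this, hnorm, hmass, sub_self]
  · rw [hsum fun y => y, ← inner_sum_apply_sum_of_diagonal hT a, ← hx, re_inner_sum_smul_apply,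
      sub_eq_zero]
    exact Finset.sum_congr rfl fun i _ => mul_comm _ _
  · intro y hy
    have := hsum fun t => (t - y)⁻¹
    simp only [← div_eq_mul_inv] at this
    rw [this, sub_nonneg]
    refine sum_div_le_of_diagonal hE hE1 (fun i => sub_pos.2 (hy _ (hpS i))) hb
      (fun j => sub_pos.2 (hy _ (hτS j))) (fun j k => ?_) a hx
    simp only [sub_smul, Finset.sum_sub_distrib, ← Finset.smul_sum, hE1,
      sub_apply, inner_sub_right, hT]
    rw [smul_apply, one_apply_eq_self, ← Complex.coe_smul,
      inner_smul_right, orthonormal_iff_ite.1 hb]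
    split_ifs <;> simp
  · intro y hy
    have := hsum fun t => (y - t)⁻¹
    simp only [← div_eq_mul_inv] at this
    rw [this, sub_nonneg]
    refine sum_div_le_of_diagonal hE hE1 (fun i => sub_pos.2 (hy _ (hpS i))) hb
      (fun j => sub_pos.2 (hy _ (hτS j))) (fun j k => ?_) a hx
    simp only [sub_smul, Finset.sum_sub_distrib, ← Finset.smul_sum, hE1,
      sub_apply, inner_sub_right, hT]
    rw [smul_apply, one_apply_eq_self, ← Complex.coe_smul,
      inner_smul_right, orthonormal_iff_ite.1 hb]
    split_ifs <;> simp

end Comparison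

/-! ### Spectral measures of finite-dimensional compressions -/

section Compression

open Polynomial Set

theorem re_inner_algebraMap_apply (r : ℝ) (x : H) :
    (inner ℂ x (algebraMap ℝ (H →L[ℂ] H) r x)).re = r * ‖x‖ ^ 2 := by
  rw [Algebra.algebraMap_eq_smul_one, smul_apply, one_apply_eq_self, ← Complex.coe_smul,
    inner_smul_right, Complex.re_ofReal_mul, ← inner_self_eq_norm_sq (𝕜 := ℂ) x]
  rfl

theorem exists_diagonal_compression {T : H →L[ℂ] H} (hT : IsSelfAdjoint T) (x : H) (n : ℕ) :
    ∃ (m : ℕ) (b : Fin m → H) (τ : Fin m → ℝ), Orthonormal ℂ b ∧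
      (∀ j k, inner ℂ (b j) (T (b k)) = if j = k then (τ j : ℂ) else 0) ∧
      x = ∑ j, inner ℂ (b j) x • b j ∧
      ∀ j, ∀ i ≤ n, inner ℂ (b j) ((T ^ i) x) = (τ j : ℂ) ^ i * inner ℂ (b j) x := by
  set F : Submodule ℂ H := Submodule.span ℂ (Set.range fun i : Fin (n + 1) => (T ^ (i : ℕ)) x)
    with hF
  have hfin : FiniteDimensional ℂ F := FiniteDimensional.span_of_finite ℂ (Set.finite_range _)
  have hmem {i : ℕ} (hi : i ≤ n) : (T ^ i) x ∈ F :=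
    Submodule.subset_span ⟨⟨i, Nat.lt_succ_of_le hi⟩, rfl⟩
  set S : F →ₗ[ℂ] F :=
    (F.orthogonalProjectionOnto ∘L T ∘L F.subtypeL : F →L[ℂ] F).toLinearMap with hS
  have hSi (u v : F) : inner ℂ u (S v) = inner ℂ (u : H) (T v) :=
    Submodule.inner_orthogonalProjectionOnto_eq_of_mem_left u (T v)
  have hTs (u v : H) : inner ℂ (T u) v = inner ℂ u (T v) :=
    ContinuousLinearMap.isSelfAdjoint_iff_isSymmetric.1 hT u v
  have hSs : S.IsSymmetric := fun u v => by
    rw [hSi, ← inner_conj_symm, hSi, inner_conj_symm, hTs]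
  set v := hSs.eigenvectorBasis rfl with hv
  have hev (j) : S (v j) = ((hSs.eigenvalues rfl j : ℝ) : ℂ) • v j :=
    hSs.apply_eigenvectorBasis rfl j
  have hbT (j) (y : F) : inner ℂ (v j : H) (T y) =
      ((hSs.eigenvalues rfl j : ℝ) : ℂ) * inner ℂ (v j : H) (y : H) := by
    rw [← hSi, ← hSs, hev, inner_smul_left, Complex.conj_ofReal, Submodule.coe_inner]
  have hortho : Orthonormal ℂ fun j => (v j : H) := v.orthonormal.comp_linearIsometry F.subtypeₗᵢ
  refine ⟨_, fun j => (v j : H), hSs.eigenvalues rfl, hortho, fun j k => ?_, ?_, fun j i => ?_⟩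
  · rw [hbT, orthonormal_iff_ite.1 hortho]
    split_ifs <;> simp
  · have h0 : x ∈ F := by simpa using hmem (Nat.zero_le n)
    have := congrArg (fun y : F => (y : H)) (v.sum_repr' ⟨x, h0⟩)
    simpa using this.symm
  · induction i with
    | zero => simp
    | succ i ih =>
      intro hi
      rw [pow_succ', mul_apply_eq_comp, hbT j ⟨_, hmem (Nat.le_of_succ_le hi)⟩,
        ih (Nat.le_of_succ_le hi), pow_succ']
      ring

theorem exists_compression_re_inner_cfc_le {T : H →L[ℂ] H} (hT : IsSelfAdjoint T) {α β : ℝ}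
    (hs : spectrum ℝ T ⊆ Icc α β) {h : ℝ → ℝ} (hh : ContinuousOn h (Icc α β)) (x : H) {ε : ℝ}
    (hε : 0 < ε) :
    ∃ (m : ℕ) (b : Fin m → H) (τ : Fin m → ℝ), Orthonormal ℂ b ∧
      (∀ j k, inner ℂ (b j) (T (b k)) = if j = k then (τ j : ℂ) else 0) ∧
      x = ∑ j, inner ℂ (b j) x • b j ∧ (∀ j, τ j ∈ Icc α β) ∧
      (inner ℂ x (cfc h T x)).re ≤ ∑ j, ‖inner ℂ (b j) x‖ ^ 2 * h (τ j) + ε * ‖x‖ ^ 2 := by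
  obtain ⟨r, hr, hrT⟩ := exists_polynomial_norm_sub_cfc_le hT hs hh (half_pos hε)
  obtain ⟨m, b, τ, hb, hbT, hx, hpow⟩ := exists_diagonal_compression hT x r.natDegree
  obtain ⟨h1, h2⟩ := (spectrum_subset_Icc_iff hT).1 hs
  have hτ (j) : τ j ∈ Icc α β := by
    have e : (inner ℂ (b j) (T (b j))).re = τ j := by simp [hbT]
    have l := re_inner_mono h1 (b j)
    have u := re_inner_mono h2 (b j)
    rw [re_inner_algebraMap_apply, hb.1 j, e] at l u
    constructor <;> linarith
  refine ⟨m, b, τ, hb, hbT, hx, hτ, ?_⟩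
  have hnorm : ‖x‖ ^ 2 = ∑ j, ‖inner ℂ (b j) x‖ ^ 2 := by
    have : inner ℂ x x = ((∑ j, ‖inner ℂ (b j) x‖ ^ 2 : ℝ) : ℂ) := by
      conv_lhs => rw [hx, hb.inner_sum]
      push_cast
      exact Finset.sum_congr rfl fun j _ => Complex.conj_mul' _
    rw [← inner_self_eq_norm_sq (𝕜 := ℂ) x, this]
    exact Complex.ofReal_re _
  have hpoly (j) : inner ℂ (b j) (aeval T r x) = ((r.eval (τ j) : ℝ) : ℂ) * inner ℂ (b j) x := by
    rw [aeval_eq_sum_range, sum_apply, inner_sum, eval_eq_sum_range, Complex.ofReal_sum,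
      Finset.sum_mul]
    refine Finset.sum_congr rfl fun i hi => ?_
    rw [smul_apply, ← Complex.coe_smul, inner_smul_right, hpow j i (Finset.mem_range_succ_iff.1 hi),
      Complex.ofReal_mul, Complex.ofReal_pow, mul_assoc]
  have hrx : (inner ℂ x (aeval T r x)).re = ∑ j, ‖inner ℂ (b j) x‖ ^ 2 * r.eval (τ j) := by
    have : inner ℂ x (aeval T r x) = ((∑ j, ‖inner ℂ (b j) x‖ ^ 2 * r.eval (τ j) : ℝ) : ℂ) := by
      conv_lhs => rw [hx, sum_inner]
      rw [← hx]
      push_cast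
      refine Finset.sum_congr rfl fun j _ => ?_
      rw [inner_smul_left, hpoly, ← Complex.conj_mul']
      ring
    rw [this, Complex.ofReal_re]
  have hdiff : (inner ℂ x (cfc h T x)).re ≤ (inner ℂ x (aeval T r x)).re + ε / 2 * ‖x‖ ^ 2 := by
    have e : (inner ℂ x (cfc h T x)).re - (inner ℂ x (aeval T r x)).re =
        -(inner ℂ x ((aeval T r - cfc h T) x)).re := by
      rw [sub_apply, inner_sub_right, Complex.sub_re]
      ring
    have l1 : -(inner ℂ x ((aeval T r - cfc h T) x)).re ≤ ‖x‖ * ‖(aeval T r - cfc h T) x‖ :=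
      (neg_le_abs _).trans ((Complex.abs_re_le_norm _).trans (norm_inner_le_norm _ _))
    have l2 : ‖(aeval T r - cfc h T) x‖ ≤ ε / 2 * ‖x‖ :=
      (ContinuousLinearMap.le_opNorm _ _).trans (mul_le_mul_of_nonneg_right hrT (norm_nonneg _))
    nlinarith [mul_le_mul_of_nonneg_left l2 (norm_nonneg x)]
  have hsum : ∑ j, ‖inner ℂ (b j) x‖ ^ 2 * r.eval (τ j) ≤
      ∑ j, (‖inner ℂ (b j) x‖ ^ 2 * h (τ j) + ε / 2 * ‖inner ℂ (b j) x‖ ^ 2) := by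
    refine Finset.sum_le_sum fun j _ => ?_
    have := (abs_lt.1 (hr _ (hτ j))).2
    nlinarith [sq_nonneg ‖inner ℂ (b j) x‖]
  rw [Finset.sum_add_distrib, ← Finset.mul_sum, ← hnorm] at hsum
  linarith

end Compression

/-! ### Finitely supported resolutions of a positive operator -/

section Resolution

open Set InnerProductSpace

theorem exists_resolution_of_finiteDimensional [FiniteDimensional ℂ H] {A : H →L[ℂ] H} (hA : 0 ≤ A)
    (hAu : IsUnit A) {h : ℝ → ℝ} (hh : ContinuousOn h (Ioi 0)) :
    ∃ (p : Fin (Module.finrank ℂ H) → ℝ) (E : Fin (Module.finrank ℂ H) → H →L[ℂ] H),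
      (∀ i, 0 < p i) ∧ (∀ i, 0 ≤ E i) ∧ ∑ i, E i = 1 ∧ ∑ i, p i • E i = A ∧
      ∑ i, h (p i) • E i = cfc h A := by
  have hs : IsSelfAdjoint A := .of_nonneg hA
  have hsymm : (A : H →ₗ[ℂ] H).IsSymmetric := ContinuousLinearMap.isSelfAdjoint_iff_isSymmetric.1 hs
  set v := hsymm.eigenvectorBasis rfl with hv
  set p := hsymm.eigenvalues rfl with hp
  have hev (j) : A (v j) = ((p j : ℝ) : ℂ) • v j := hsymm.apply_eigenvectorBasis rfl j
  have happly (g : ℝ → ℝ) (j) : (∑ i, g (p i) • rankOne ℂ (v i) (v i)) (v j) =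
      ((g (p j) : ℝ) : ℂ) • v j := by
    simp only [sum_apply, smul_apply, rankOne_apply, orthonormal_iff_ite.1 v.orthonormal]
    simp [← Complex.coe_smul]
  have hext {X Y : H →L[ℂ] H} (hXY : ∀ j, X (v j) = Y (v j)) : X = Y :=
    ContinuousLinearMap.coe_injective (v.toBasis.ext fun j => by simpa using hXY j)
  refine ⟨p, fun i => rankOne ℂ (v i) (v i), fun i => ?_, fun i => ?_, ?_, ?_, ?_⟩
  · exact pos_of_mem_spectrum hA hAu
      (mem_spectrum_of_apply_eq_smul (v.orthonormal.ne_zero i) (hev i))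
  · exact (ContinuousLinearMap.nonneg_iff_isPositive _).2 (isPositive_rankOne_self _)
  · exact v.sum_rankOne_eq_id
  · exact hext fun j => (happly (fun t => t) j).trans (hev j).symm
  · exact hext fun j => (happly h j).trans (cfc_apply_of_apply_eq_smul hA hAu hh (hev j)).symm

theorem exists_bernstein_partition {α β : ℝ} (hαβ : α < β) {h : ℝ → ℝ}
    (hh : ContinuousOn h (Icc α β)) {ε : ℝ} (hε : 0 < ε) :
    ∃ (n : ℕ) (p : Fin n → ℝ) (φ : Fin n → ℝ → ℝ), (∀ i, p i ∈ Icc α β) ∧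
      (∀ i, Continuous (φ i)) ∧ (∀ i, ∀ t ∈ Icc α β, 0 ≤ φ i t) ∧ (∀ t, ∑ i, φ i t = 1) ∧
      (∀ t, ∑ i, p i * φ i t = t) ∧ ∀ t ∈ Icc α β, ∑ i, h (p i) * φ i t ≤ h t + ε := by
  have hd : 0 < β - α := sub_pos.2 hαβ
  have hmaps (s : unitInterval) : α + (β - α) * s ∈ Icc α β := by
    have := s.2.1; have := s.2.2
    constructor <;> nlinarith
  let F : C(unitInterval, ℝ) := ⟨fun s => h (α + (β - α) * s),
    hh.comp_continuous (by fun_prop) hmaps⟩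
  have hlim := bernsteinApproximation_uniform F
  obtain ⟨n, hn0, hn⟩ := ((Filter.eventually_gt_atTop 0).and
    (hlim.eventually (Metric.ball_mem_nhds F hε))).exists
  have hn0' : (n : ℝ) ≠ 0 := by positivity
  have hsum1 (s : ℝ) : ∑ i : Fin (n + 1), (bernsteinPolynomial ℝ n i).eval s = 1 := by
    rw [Fin.sum_univ_eq_sum_range (fun i => (bernsteinPolynomial ℝ n i).eval s),
      ← Polynomial.eval_finsetSum, bernsteinPolynomial.sum, Polynomial.eval_one]
  have hsum2 (s : ℝ) : ∑ i : Fin (n + 1), (i : ℝ) / n * (bernsteinPolynomial ℝ n i).eval s = s := by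
    have := congrArg (Polynomial.eval s) (bernsteinPolynomial.sum_smul ℝ n)
    rw [Polynomial.eval_finsetSum] at this
    simp only [nsmul_eq_mul, Polynomial.eval_mul, Polynomial.eval_natCast,
      Polynomial.eval_X] at this
    rw [Fin.sum_univ_eq_sum_range (fun i => (i : ℝ) / n * (bernsteinPolynomial ℝ n i).eval s)]
    simp_rw [div_mul_eq_mul_div]
    rw [← Finset.sum_div, this]
    field_simp
  have hunit {t : ℝ} (ht : t ∈ Icc α β) : (t - α) / (β - α) ∈ unitInterval :=
    ⟨div_nonneg (sub_nonneg.2 ht.1) hd.le, (div_le_one hd).2 (by linarith [ht.2])⟩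
  refine ⟨n + 1, fun i => α + (β - α) * (i / n),
    fun i t => (bernsteinPolynomial ℝ n i).eval ((t - α) / (β - α)), fun i => ?_, fun i => ?_,
    fun i t ht => ?_, fun t => hsum1 _, fun t => ?_, fun t ht => ?_⟩
  · exact hmaps (bernstein.z i)
  · fun_prop
  · exact bernstein_nonneg (n := n) (ν := i) (x := ⟨_, hunit ht⟩)
  · simp_rw [add_mul]
    rw [Finset.sum_add_distrib, ← Finset.mul_sum, hsum1]
    simp_rw [mul_assoc]
    rw [← Finset.mul_sum, hsum2]
    field_simp
    ring
  · have hb := (abs_lt.1 ((ContinuousMap.norm_coe_le_norm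
      (bernsteinApproximation n F - F) ⟨_, hunit ht⟩).trans_lt (mem_ball_iff_norm.1 hn))).2
    rw [ContinuousMap.sub_apply, bernsteinApproximation.apply] at hb
    have e : F ⟨_, hunit ht⟩ = h t := by
      change h _ = h t
      congr 1
      change α + (β - α) * ((t - α) / (β - α)) = t
      field_simp
      ring
    rw [e, sub_lt_iff_lt_add'] at hb
    refine (le_of_eq ?_).trans hb.le
    exact Finset.sum_congr rfl fun i _ => mul_comm _ _

theorem exists_resolution {A : H →L[ℂ] H} (hA : 0 ≤ A) (hAu : IsUnit A) {h : ℝ → ℝ}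
    (hh : ContinuousOn h (Ioi 0)) {ε : ℝ} (hε : 0 < ε) :
    ∃ (n : ℕ) (p : Fin n → ℝ) (E : Fin n → H →L[ℂ] H), (∀ i, 0 < p i) ∧ (∀ i, 0 ≤ E i) ∧
      ∑ i, E i = 1 ∧ ∑ i, p i • E i = A ∧
      ∑ i, h (p i) • E i ≤ cfc h A + algebraMap ℝ (H →L[ℂ] H) ε := by
  have hs : IsSelfAdjoint A := .of_nonneg hA
  obtain ⟨α, β, hα, hsp⟩ := exists_spectrum_subset_Icc hA hAu
  have hsp' : spectrum ℝ A ⊆ Icc α (max β (α + 1)) :=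
    hsp.trans (Icc_subset_Icc le_rfl (le_max_left _ _))
  obtain ⟨n, p, φ, hp, hφc, hφ0, hφ1, hφt, hφh⟩ := exists_bernstein_partition
    ((lt_add_one α).trans_le (le_max_right β (α + 1)))
    (hh.mono fun t ht => hα.trans_le ht.1) hε
  have hc (i) : ContinuousOn (φ i) (spectrum ℝ A) := (hφc i).continuousOn
  have hlin (c : Fin n → ℝ) : ∑ i, c i • cfc (φ i) A = cfc (fun t => ∑ i, c i * φ i t) A := by
    rw [← Finset.sum_fn Finset.univ fun i t => c i * φ i t,
      cfc_sum (fun i t => c i * φ i t) A Finset.univ fun i _ => continuousOn_const.mul (hc i)]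
    exact Finset.sum_congr rfl fun i _ => (cfc_const_mul _ _ _ (hc i)).symm
  refine ⟨n, p, fun i => cfc (φ i) A, fun i => hα.trans_le (hp i).1,
    fun i => cfc_nonneg fun t ht => hφ0 i t (hsp' ht), ?_, ?_, ?_⟩
  · have := hlin fun _ => 1
    simp only [one_smul, one_mul, hφ1] at this
    rw [this, cfc_const_one ℝ A]
  · rw [hlin, cfc_congr fun t _ => hφt t, cfc_id' ℝ A]
  · have hhc := continuousOn_spectrum hA hAu hh
    rw [hlin, ← cfc_const ε A, ← cfc_add _ _ _ hhc continuousOn_const]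
    exact _root_.cfc_mono (fun t ht => hφh t (hsp' ht))
      (continuousOn_finsetSum _ fun i _ => continuousOn_const.mul (hc i))
      (hhc.add continuousOn_const)

end Resolution

/-! ### The Jensen and Kadison inequalities for unital positive maps -/

section Jensen

open Set

variable {Φ : (H →L[ℂ] H) →ₗ[ℂ] (H →L[ℂ] H)}

theorem IsUnitalPositiveMap.mono (hΦ : IsUnitalPositiveMap Φ) {X Y : H →L[ℂ] H} (h : X ≤ Y) :
    Φ X ≤ Φ Y := by
  have := hΦ.2 (Y - X) (sub_nonneg.2 h)
  rwa [map_sub, sub_nonneg] at this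

theorem map_real_smul_of_complex_linear (Φ : (H →L[ℂ] H) →ₗ[ℂ] (H →L[ℂ] H)) (r : ℝ)
    (X : H →L[ℂ] H) : Φ (r • X) = r • Φ X := by
  rw [← Complex.coe_smul, map_smul, Complex.coe_smul]

theorem IsUnitalPositiveMap.map_algebraMap (hΦ : IsUnitalPositiveMap Φ) (r : ℝ) :
    Φ (algebraMap ℝ _ r) = algebraMap ℝ _ r := by
  rw [Algebra.algebraMap_eq_smul_one, map_real_smul_of_complex_linear, hΦ.1]

theorem IsUnitalPositiveMap.isSelfAdjoint_map (hΦ : IsUnitalPositiveMap Φ) {X : H →L[ℂ] H}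
    (hX : IsSelfAdjoint X) : IsSelfAdjoint (Φ X) := by
  have h := hX.neg_algebraMap_norm_le_self
  have h0 : 0 ≤ Φ (X + algebraMap ℝ _ ‖X‖) := hΦ.2 _ (by
    rw [neg_le_iff_add_nonneg] at h
    exact h)
  have := (IsSelfAdjoint.of_nonneg h0).sub
    (IsSelfAdjoint.algebraMap (H →L[ℂ] H) (IsSelfAdjoint.all ‖X‖))
  rwa [map_add, hΦ.map_algebraMap, add_sub_cancel_right] at this

theorem IsUnitalPositiveMap.isUnit_map (hΦ : IsUnitalPositiveMap Φ) {A : H →L[ℂ] H}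
    (hA : 0 ≤ A) (hAu : IsUnit A) : IsUnit (Φ A) := by
  obtain ⟨a, b, ha, hs⟩ := exists_spectrum_subset_Icc hA hAu
  have := hΦ.mono ((spectrum_subset_Icc_iff (.of_nonneg hA)).1 hs).1
  rw [hΦ.map_algebraMap] at this
  exact isUnit_of_algebraMap_le (.of_nonneg (hΦ.2 A hA)) ha this

theorem exists_orthonormal_of_not_finiteDimensional (h : ¬ FiniteDimensional ℂ H) (N : ℕ) :
    ∃ e : Fin N → H, Orthonormal ℂ e := by
  have hr : Cardinal.aleph0 ≤ Module.rank ℂ H := by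
    rw [← not_lt, Module.rank_lt_aleph0_iff]
    exact h
  obtain ⟨f, hf⟩ := exists_linearIndependent_of_le_rank
    ((Cardinal.natCast_le_aleph0 (n := N)).trans hr)
  exact ⟨InnerProductSpace.gramSchmidtNormed ℂ f,
    InnerProductSpace.gramSchmidtNormed_orthonormal hf⟩

theorem IsUnitalPositiveMap.resolution_map (hΦ : IsUnitalPositiveMap Φ) {n : ℕ}
    {E : Fin n → H →L[ℂ] H} (hE1 : ∑ i, E i = 1) : ∑ i, Φ (E i) = 1 := by
  rw [← map_sum, hE1, hΦ.1]

theorem sum_smul_map (Φ : (H →L[ℂ] H) →ₗ[ℂ] (H →L[ℂ] H)) {n : ℕ} (c : Fin n → ℝ)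
    (E : Fin n → H →L[ℂ] H) : ∑ i, c i • Φ (E i) = Φ (∑ i, c i • E i) := by
  rw [map_sum]
  exact Finset.sum_congr rfl fun i _ => (map_real_smul_of_complex_linear Φ _ _).symm

theorem IsUnitalPositiveMap.re_inner_sum_le (hΦ : IsUnitalPositiveMap Φ) {n : ℕ}
    {c : Fin n → ℝ} {E : Fin n → H →L[ℂ] H} {X : H →L[ℂ] H} {ε : ℝ}
    (h : ∑ i, c i • E i ≤ X + algebraMap ℝ (H →L[ℂ] H) ε) (x : H) :
    ∑ i, (inner ℂ x (Φ (E i) x)).re * c i ≤ (inner ℂ x (Φ X x)).re + ε * ‖x‖ ^ 2 := by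
  have := re_inner_mono (hΦ.mono h) x
  rw [← sum_smul_map, re_inner_sum_smul_apply, map_add, hΦ.map_algebraMap, add_apply,
    inner_add_right, Complex.add_re, re_inner_algebraMap_apply] at this
  refine le_trans (le_of_eq ?_) this
  exact Finset.sum_congr rfl fun i _ => mul_comm _ _

theorem IsUnitalPositiveMap.cfc_map_le (hΦ : IsUnitalPositiveMap Φ) {h : ℝ → ℝ}
    (hh : ContinuousOn h (Ioi 0))
    (hconv : ∀ (N : ℕ) (e : Fin N → H), Orthonormal ℂ e → DividedDifferenceConvex N h)
    {A : H →L[ℂ] H} (hA : 0 ≤ A) (hAu : IsUnit A) : cfc h (Φ A) ≤ Φ (cfc h A) := by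
  have hT0 := hΦ.2 A hA
  have hTs : IsSelfAdjoint (Φ A) := .of_nonneg hT0
  obtain ⟨α, β, hα, hsp⟩ := exists_spectrum_subset_Icc hT0 (hΦ.isUnit_map hA hAu)
  refine le_of_re_inner_le (cfc_predicate _ _) (hΦ.isSelfAdjoint_map (cfc_predicate _ _))
    fun x => ?_
  suffices H : ∀ ε > 0, (inner ℂ x (cfc h (Φ A) x)).re ≤
      (inner ℂ x (Φ (cfc h A) x)).re + (2 * ‖x‖ ^ 2) * ε by
    have hlim : Filter.Tendsto
        (fun ε : ℝ => (inner ℂ x (Φ (cfc h A) x)).re + (2 * ‖x‖ ^ 2) * ε)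
        (nhdsWithin 0 (Ioi 0)) (nhds (inner ℂ x (Φ (cfc h A) x)).re) := by
      have : Continuous fun ε : ℝ => (inner ℂ x (Φ (cfc h A) x)).re + (2 * ‖x‖ ^ 2) * ε := by
        fun_prop
      simpa using (this.tendsto 0).mono_left nhdsWithin_le_nhds
    exact ge_of_tendsto hlim (by filter_upwards [self_mem_nhdsWithin] with ε hε using H ε hε)
  intro ε hε
  obtain ⟨m, b, τ, hb, hbT, hx, hτ, hle⟩ := exists_compression_re_inner_cfc_le hTs hsp
    (hh.mono fun t ht => hα.trans_le ht.1) x hε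
  have hcompare {n N : ℕ} {p : Fin n → ℝ} {E : Fin n → H →L[ℂ] H} (hp : ∀ i, 0 < p i)
      (hE : ∀ i, 0 ≤ E i) (hE1 : ∑ i, E i = 1) (hEA : ∑ i, p i • E i = A)
      (hEh : ∑ i, h (p i) • E i ≤ cfc h A + algebraMap ℝ (H →L[ℂ] H) ε)
      (hN : n + m ≤ 2 * N) (hcN : DividedDifferenceConvex N h) :
      (inner ℂ x (cfc h (Φ A) x)).re ≤
        (inner ℂ x (Φ (cfc h A) x)).re + (2 * ‖x‖ ^ 2) * ε := by
    have h1 := hcN.sum_le_sum_of_diagonal (fun i => hΦ.2 _ (hE i)) (hΦ.resolution_map hE1) hp hb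
      (fun j => hα.trans_le (hτ j).1) (by rwa [sum_smul_map, hEA]) _ hx (by simpa using hN)
    have h2 := hΦ.re_inner_sum_le hEh x
    linarith
  by_cases hfin : FiniteDimensional ℂ H
  · obtain ⟨p, E, hp, hE, hE1, hEA, hEh⟩ := exists_resolution_of_finiteDimensional hA hAu hh
    have hm : m ≤ Module.finrank ℂ H := by
      simpa using hb.linearIndependent.fintype_card_le_finrank
    refine hcompare hp hE hE1 hEA (hEh.trans_le ?_) (by omega)
      (hconv _ _ (stdOrthonormalBasis ℂ H).orthonormal)
    exact le_add_of_nonneg_right (algebraMap_nonneg_of_pos hε)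
  · obtain ⟨n, p, E, hp, hE, hE1, hEA, hEh⟩ := exists_resolution hA hAu hh hε
    obtain ⟨e, he⟩ := exists_orthonormal_of_not_finiteDimensional hfin (n + m)
    exact hcompare hp hE hE1 hEA hEh (by omega) (hconv _ e he)

/-- The Kadison inequality. -/
theorem IsUnitalPositiveMap.map_mul_self_le (hΦ : IsUnitalPositiveMap Φ) {B : H →L[ℂ] H}
    (hB : 0 ≤ B) (hBu : IsUnit B) : Φ B * Φ B ≤ Φ (B * B) := by
  have hs : IsSelfAdjoint B := .of_nonneg hB
  have hFs : IsSelfAdjoint (Φ B) := .of_nonneg (hΦ.2 B hB)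
  have hsq : cfc (fun t : ℝ => t ^ 2) B = B * B := by rw [cfc_pow_id B 2, sq]
  have hF (x : H) : (inner ℂ x ((Φ B * Φ B) x)).re = ‖Φ B x‖ ^ 2 := by
    have h1 : inner ℂ (Φ B x) (Φ B x) = inner ℂ x (Φ B (Φ B x)) :=
      ContinuousLinearMap.isSelfAdjoint_iff_isSymmetric.1 hFs x (Φ B x)
    rw [mul_apply_eq_comp, ← h1]
    exact inner_self_eq_norm_sq (𝕜 := ℂ) _
  refine le_of_re_inner_le (by rw [← sq]; exact hFs.pow 2) (hΦ.isSelfAdjoint_map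
    (by rw [← sq]; exact hs.pow 2)) fun x => ?_
  rw [hF]
  have hlim : Filter.Tendsto (fun ε : ℝ => (inner ℂ x (Φ (B * B) x)).re + ε * ‖x‖ ^ 2)
      (nhdsWithin 0 (Ioi 0)) (nhds (inner ℂ x (Φ (B * B) x)).re) := by
    have : Continuous fun ε : ℝ => (inner ℂ x (Φ (B * B) x)).re + ε * ‖x‖ ^ 2 := by fun_prop
    simpa using (this.tendsto 0).mono_left nhdsWithin_le_nhds
  refine ge_of_tendsto hlim ?_
  filter_upwards [self_mem_nhdsWithin] with ε hε
  obtain ⟨n, p, E, hp, hE, hE1, hEB, hEh⟩ := exists_resolution hB hBu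
    (h := fun t => t ^ 2) (by fun_prop) hε
  have h1 := re_inner_sq_le (fun i => hΦ.2 _ (hE i)) (hΦ.resolution_map hE1) p x
  rw [sum_smul_map, hEB] at h1
  rw [hsq] at hEh
  exact h1.trans (hΦ.re_inner_sum_le hEh x)

end Jensen

/-! ### The functions to which the Jensen inequality is applied -/

section Chain

open Set

variable {f : ℝ → ℝ}

theorem IsOperatorConcaveOn.cfc_sqrt_mono (hf2 : IsOperatorConcaveOn H fun t => f t ^ 2)
    (hfc : ContinuousOn f (Ioi 0)) (hf1 : ∀ t, 0 < t → 1 ≤ f t) (A B : H →L[ℂ] H) (hA : 0 ≤ A)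
    (hAu : IsUnit A) (hAB : A ≤ B) : cfc f A ≤ cfc f B :=
  cfc_mono_of_cfc_sq_mono hfc (fun t ht => zero_le_one.trans (hf1 t ht)) hA hAu hAB
    (hf2.cfc_mono (hfc.pow 2) (fun _ _ => sq_nonneg _) hA hAu hAB)

theorem IsOperatorConcaveOn.dividedDifferenceConvex_neg [Nontrivial H] {g : ℝ → ℝ}
    (hg : IsOperatorConcaveOn H g) (hgc : ContinuousOn g (Ioi 0)) (hg0 : ∀ t, 0 < t → 0 ≤ g t)
    {N : ℕ} {e : Fin N → H} (he : Orthonormal ℂ e) :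
    DividedDifferenceConvex N fun t => -g t :=
  (dividedDifferenceMonotone_of_operatorMonotone he hgc
    fun _ _ hA hAu hAB => hg.cfc_mono hgc hg0 hA hAu hAB).neg_convex hg0
    fun _ ht => hg.le_linear hg0 ht

theorem IsOperatorConcaveOn.dividedDifferenceConvex_mul_sqrt [Nontrivial H]
    (hf2 : IsOperatorConcaveOn H fun t => f t ^ 2) (hfc : ContinuousOn f (Ioi 0))
    (hf1 : ∀ t, 0 < t → 1 ≤ f t) {N : ℕ} {e : Fin N → H} (he : Orthonormal ℂ e) :
    DividedDifferenceConvex N fun t => t * f t := by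
  have hmono := hf2.cfc_sqrt_mono hfc hf1
  refine (dividedDifferenceMonotone_of_operatorMonotone he hfc hmono).mul_self_convex
    (K := f 1) fun t ht ht1 => ?_
  rw [abs_of_nonneg (zero_le_one.trans (hf1 t ht))]
  exact monotoneOn_of_cfc_mono hmono ht (mem_Ioi.2 one_pos) ht1.le

theorem IsOperatorConcaveOn.dividedDifferenceConvex_mul_neg_inv_sqrt
    (hf2 : IsOperatorConcaveOn H fun t => f t ^ 2) (hfc : ContinuousOn f (Ioi 0))
    (hf1 : ∀ t, 0 < t → 1 ≤ f t) {N : ℕ} {e : Fin N → H} (he : Orthonormal ℂ e) :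
    DividedDifferenceConvex N fun t => t * -(f t)⁻¹ := by
  refine (dividedDifferenceMonotone_of_operatorMonotone (f := fun t => -(f t)⁻¹) he
    (hfc.inv₀ fun t ht => (zero_lt_one.trans_le (hf1 t ht)).ne').neg fun A B hA hAu hAB =>
      cfc_neg_inv_mono hfc hf1 hA hAu hAB
        (hf2.cfc_sqrt_mono hfc hf1 A B hA hAu hAB)).mul_self_convex
    (K := 1) fun t ht _ => ?_
  rw [abs_neg, abs_inv, abs_of_nonneg (zero_le_one.trans (hf1 t ht))]
  exact inv_le_one_of_one_le₀ (hf1 t ht)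

/-! ### Absolute values of products -/

theorem opAbs_mul_le_opAbs_mul {Y Z : H →L[ℂ] H} (h : star Y * Y ≤ star Z * Z) (T : H →L[ℂ] H) :
    opAbs (Y * T) ≤ opAbs (Z * T) := by
  have hc := star_left_conjugate_le_conjugate h T
  refine CFC.sqrt_le_sqrt _ _ ?_
  simpa only [star_mul, mul_assoc] using hc

theorem cfc_mul_id {T : H →L[ℂ] H} (hT : 0 ≤ T) (hTu : IsUnit T) {k : ℝ → ℝ}
    (hk : ContinuousOn k (Ioi 0)) : T * cfc k T = cfc (fun t => t * k t) T := by
  have hs : IsSelfAdjoint T := .of_nonneg hT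
  rw [cfc_mul (fun t => t) k T continuousOn_id (continuousOn_spectrum hT hTu hk), cfc_id' ℝ T]

theorem opAbs_cfc_mul {T : H →L[ℂ] H} (hT : 0 ≤ T) (hTu : IsUnit T) {k : ℝ → ℝ}
    (hk : ContinuousOn k (Ioi 0)) (hk0 : ∀ t, 0 < t → 0 ≤ k t) :
    opAbs (cfc k T * T) = T * cfc k T := by
  have hs : IsSelfAdjoint T := .of_nonneg hT
  have hcomm : cfc k T * T = T * cfc k T := by
    have h := (cfc_commute_cfc k (fun t : ℝ => t) T).eq
    rwa [cfc_id' ℝ T] at h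
  have h0 : 0 ≤ T * cfc k T := by
    rw [cfc_mul_id hT hTu hk]
    exact cfc_nonneg fun t ht => mul_nonneg (pos_of_mem_spectrum hT hTu ht).le
      (hk0 t (pos_of_mem_spectrum hT hTu ht))
  rw [hcomm, opAbs, (IsSelfAdjoint.of_nonneg h0).star_eq]
  exact CFC.sqrt_unique rfl h0

theorem ringInverse_mul_self {X : H →L[ℂ] H} (hX : IsUnit X) :
    Ring.inverse (X * X) = Ring.inverse X * Ring.inverse X := by
  obtain ⟨u, rfl⟩ := hX
  rw [← Units.val_mul, Ring.inverse_unit, Ring.inverse_unit, mul_inv_rev, Units.val_mul]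

theorem one_le_mul_self {X : H →L[ℂ] H} (hX : 1 ≤ X) : 1 ≤ X * X := by
  have h0 : 0 ≤ X - 1 := sub_nonneg.2 hX
  have h1 : 0 ≤ star (X - 1) * (X - 1) := star_mul_self_nonneg _
  rw [(IsSelfAdjoint.of_nonneg h0).star_eq] at h1
  rw [← sub_nonneg]
  have e : X * X - 1 = (X - 1) * (X - 1) + ((X - 1) + (X - 1)) := by noncomm_ring
  rw [e]
  exact add_nonneg h1 (add_nonneg h0 h0)

end Chain

/-- **Corollary 2.6, chain.** If `f : (0,∞) → (0,∞)` is continuous, `f²` is operator concave,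
and `f(t) ≥ 1` for all `t > 0`, then
`Φ(A f(A)⁻¹) ≤ |Φ(f(A))⁻¹ Φ(A)| ≤ |Φ(f(A)) Φ(A)| ≤ Φ(A f(A))` for every unital positive linear
map `Φ` and every positive invertible operator `A`. -/
theorem abs_choi_davis_chain
    (Φ : (H →L[ℂ] H) →ₗ[ℂ] (H →L[ℂ] H)) (hΦ : IsUnitalPositiveMap Φ)
    (f : ℝ → ℝ)
    (hfc : ContinuousOn f (Set.Ioi 0))
    (hfpos : ∀ t ∈ Set.Ioi (0 : ℝ), 0 < f t)
    (hf2 : IsOperatorConcaveOn H (fun t => f t ^ 2))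
    (hf1 : ∀ t ∈ Set.Ioi (0 : ℝ), 1 ≤ f t)
    (A : H →L[ℂ] H) (hA : 0 ≤ A) (hAu : IsUnit A) :
    Φ (A * cfc (fun t => (f t)⁻¹) A) ≤ opAbs (Ring.inverse (Φ (cfc f A)) * Φ A) ∧
      opAbs (Ring.inverse (Φ (cfc f A)) * Φ A) ≤ opAbs (Φ (cfc f A) * Φ A) ∧
      opAbs (Φ (cfc f A) * Φ A) ≤ Φ (A * cfc f A) := by
  have hf1' : ∀ t, 0 < t → 1 ≤ f t := hf1
  have hf0 : ∀ t, 0 < t → 0 ≤ f t := fun t ht => (hfpos t ht).le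
  have hfic : ContinuousOn (fun t => (f t)⁻¹) (Set.Ioi 0) :=
    hfc.inv₀ fun t ht => (hfpos t ht).ne'
  rcases subsingleton_or_nontrivial H with hH | hH
  · have hop (X Y : H →L[ℂ] H) : X ≤ Y := le_of_eq (Subsingleton.elim X Y)
    exact ⟨hop _ _, hop _ _, hop _ _⟩
  have hT : 0 ≤ Φ A := hΦ.2 A hA
  have hTu : IsUnit (Φ A) := hΦ.isUnit_map hA hAu
  have hTs : IsSelfAdjoint (Φ A) := .of_nonneg hT
  have hAs : IsSelfAdjoint A := .of_nonneg hA
  have hB1 : 1 ≤ cfc f A := one_le_cfc_of_one_le hfc hf1' hA hAu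
  have hB0 : 0 ≤ cfc f A := zero_le_one.trans hB1
  have hBu : IsUnit (cfc f A) := CStarAlgebra.isUnit_of_le 1 hB1 ⟨zero_le_one, isUnit_one⟩
  have hF1 : 1 ≤ Φ (cfc f A) := by simpa only [hΦ.1] using hΦ.mono hB1
  have hF0 : 0 ≤ Φ (cfc f A) := zero_le_one.trans hF1
  have hFu : IsUnit (Φ (cfc f A)) := hΦ.isUnit_map hB0 hBu
  have hFs : IsSelfAdjoint (Φ (cfc f A)) := .of_nonneg hF0
  have hFF1 : 1 ≤ Φ (cfc f A) * Φ (cfc f A) := one_le_mul_self hF1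
  have hFFu : IsStrictlyPositive (Φ (cfc f A) * Φ (cfc f A)) :=
    ⟨zero_le_one.trans hFF1, hFu.mul hFu⟩
  have hsq {X : H →L[ℂ] H} (hX : 0 ≤ X) (hXu : IsUnit X) :
      cfc (fun t => f t ^ 2) X = cfc f X * cfc f X := by
    have hc := continuousOn_spectrum hX hXu hfc
    rw [← cfc_mul f f X hc hc]
    simp only [sq]
  have hstar : star (Ring.inverse (Φ (cfc f A))) * Ring.inverse (Φ (cfc f A)) =
      Ring.inverse (Φ (cfc f A) * Φ (cfc f A)) := by
    rw [ringInverse_mul_self hFu, ← Ring.inverse_star, hFs.star_eq]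
  have hle : Φ (cfc f A) * Φ (cfc f A) ≤ cfc f (Φ A) * cfc f (Φ A) := by
    have hJ := hΦ.cfc_map_le (hfc.pow 2).neg (fun _ _ he =>
      hf2.dividedDifferenceConvex_neg (hfc.pow 2) (fun _ _ => sq_nonneg _) he) hA hAu
    have hJ' : -cfc (fun t => f t ^ 2) (Φ A) ≤ Φ (-cfc (fun t => f t ^ 2) A) := by
      rw [← cfc_neg, ← cfc_neg]
      exact hJ
    rw [map_neg, neg_le_neg_iff, hsq hA hAu, hsq hT hTu] at hJ'
    exact (hΦ.map_mul_self_le hB0 hBu).trans hJ'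
  refine ⟨?_, ?_, ?_⟩
  · have hJ := hΦ.cfc_map_le (continuousOn_id.mul hfic.neg) (fun _ _ he =>
      hf2.dividedDifferenceConvex_mul_neg_inv_sqrt hfc hf1' he) hA hAu
    have hJ' : cfc (fun t => t * -(f t)⁻¹) (Φ A) ≤ Φ (cfc (fun t => t * -(f t)⁻¹) A) := hJ
    rw [← cfc_mul_id (k := fun t => -(f t)⁻¹) hT hTu hfic.neg,
      ← cfc_mul_id (k := fun t => -(f t)⁻¹) hA hAu hfic.neg, cfc_neg, cfc_neg, mul_neg,
      mul_neg, map_neg, neg_le_neg_iff] at hJ'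
    refine hJ'.trans ?_
    rw [← opAbs_cfc_mul hT hTu hfic fun t ht => inv_nonneg.2 (hf0 t ht)]
    refine opAbs_mul_le_opAbs_mul ?_ _
    have hfT1 := one_le_cfc_of_one_le hfc hf1' hT hTu
    have hfTu : IsUnit (cfc f (Φ A)) :=
      CStarAlgebra.isUnit_of_le 1 hfT1 ⟨zero_le_one, isUnit_one⟩
    have hinv : cfc (fun t => (f t)⁻¹) (Φ A) = Ring.inverse (cfc f (Φ A)) :=
      cfc_inv f (Φ A) (fun t ht => (hfpos t (pos_of_mem_spectrum hT hTu ht)).ne')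
        (continuousOn_spectrum hT hTu hfc)
    rw [hstar, (cfc_predicate (R := ℝ) (fun t => (f t)⁻¹) (Φ A) : IsSelfAdjoint _).star_eq, hinv,
      ← ringInverse_mul_self hfTu]
    exact CStarAlgebra.ringInverse_le_ringInverse hle hFFu
  · refine opAbs_mul_le_opAbs_mul ?_ _
    rw [hstar, hFs.star_eq]
    have h1 := CStarAlgebra.ringInverse_le_ringInverse hFF1 ⟨zero_le_one, isUnit_one⟩
    rw [Ring.inverse_one] at h1
    exact h1.trans hFF1
  · have hJ := hΦ.cfc_map_le (continuousOn_id.mul hfc) (fun _ _ he =>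
      hf2.dividedDifferenceConvex_mul_sqrt hfc hf1' he) hA hAu
    have hJ' : cfc (fun t => t * f t) (Φ A) ≤ Φ (cfc (fun t => t * f t) A) := hJ
    rw [← cfc_mul_id hT hTu hfc, ← cfc_mul_id hA hAu hfc] at hJ'
    refine le_trans ?_ hJ'
    rw [← opAbs_cfc_mul hT hTu hfc hf0]
    refine opAbs_mul_le_opAbs_mul ?_ _
    rwa [hFs.star_eq, (cfc_predicate (R := ℝ) f (Φ A) : IsSelfAdjoint _).star_eq]
end

section
/- Let Φ be a unital positive linear map on B(H) and let 0 ≤ γ ≤ 1/2. Then for every positive invertible operator A ∈ B(H), |Φ(A^γ) Φ(A)| ≤ Φ(A^{γ+1}). -/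
open scoped NNReal

variable {H : Type*} [NormedAddCommGroup H] [InnerProductSpace ℂ H] [CompleteSpace H]

open MeasureTheory Ring

namespace PositiveLinearMap

variable {A B : Type*} [CStarAlgebra A] [PartialOrder A] [CStarAlgebra B] [PartialOrder B]

lemma map_algebraMap (Φ : A →ₚ[ℂ] B) (hΦ : Φ 1 = 1) (t : ℝ) :
    Φ (algebraMap ℝ A t) = algebraMap ℝ B t := by
  rw [Algebra.algebraMap_eq_smul_one, ← Complex.coe_smul, map_smul, hΦ, Complex.coe_smul,
    ← Algebra.algebraMap_eq_smul_one]

variable [StarOrderedRing A] [StarOrderedRing B]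

/-- If `q k ≥ 0` are elements with total mass `1` and mean `m`, then `m ^ 2` is at most their second
moment. -/
lemma sq_sum_nsmul_le {n : ℕ} (q : ℕ → B) (hq : ∀ k, 0 ≤ q k)
    (hsum : ∑ k ∈ Finset.range n, q k = 1) :
    (∑ k ∈ Finset.range n, k • q k) ^ 2 ≤ ∑ k ∈ Finset.range n, (k ^ 2) • q k := by
  set m := ∑ k ∈ Finset.range n, k • q k with hm
  have hmsa : IsSelfAdjoint m :=
    .of_nonneg (Finset.sum_nonneg fun k _ => nsmul_nonneg (hq k) k)
  have key : 0 ≤ ∑ k ∈ Finset.range n, (m - (k : B)) * q k * (m - (k : B)) :=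
    Finset.sum_nonneg fun k _ =>
      (hmsa.sub (.natCast k)).conjugate_nonneg (hq k)
  have expand : ∀ k : ℕ, (m - (k : B)) * q k * (m - (k : B))
      = m * q k * m - m * (k • q k) - (k • q k) * m + (k ^ 2) • q k := by
    intro k
    simp only [nsmul_eq_mul, Nat.cast_pow]
    have h₁ : q k * (k : B) = k * q k := (Nat.cast_commute k (q k)).eq.symm
    calc _ = m * q k * m - m * (q k * k) - k * q k * m + k * (q k * k) := by noncomm_ring
      _ = _ := by rw [h₁]; noncomm_ring
  simp_rw [expand, Finset.sum_add_distrib, Finset.sum_sub_distrib, ← Finset.mul_sum,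
    ← Finset.sum_mul, ← Finset.mul_sum, hsum, ← hm, mul_one] at key
  rw [← sub_nonneg]
  convert key using 1
  noncomm_ring

lemma aeval_bernsteinPolynomial_nonneg {b : A} (hb : 0 ≤ b) (hb1 : b ≤ 1) (n k : ℕ) :
    0 ≤ Polynomial.aeval b (bernsteinPolynomial ℝ n k) := by
  have h1 : 0 ≤ 1 - b := sub_nonneg.mpr hb1
  have hc : Commute (b ^ k) ((1 - b) ^ (n - k)) :=
    ((Commute.one_right b).sub_right (Commute.refl b)).pow_pow _ _
  have := nsmul_nonneg (hc.mul_nonneg (CStarAlgebra.pow_nonneg hb k)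
    (CStarAlgebra.pow_nonneg h1 (n - k))) (n.choose k)
  simpa [bernsteinPolynomial, mul_assoc] using this

lemma map_sq_le_of_le_one (Φ : A →ₚ[ℂ] B) (hΦ : Φ 1 = 1) {b : A} (hb : 0 ≤ b) (hb1 : b ≤ 1) :
    Φ b ^ 2 ≤ Φ (b ^ 2) := by
  have bound : ∀ n : ℕ, Φ b ^ 2 ≤ Φ (b ^ 2) + ((n : ℝ) + 1)⁻¹ • (Φ b - Φ (b ^ 2)) := by
    intro m
    set n := m + 1 with hn
    set c : ℕ → A := fun k => Polynomial.aeval b (bernsteinPolynomial ℝ n k)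
    have h₀ : ∑ k ∈ Finset.range (n + 1), c k = 1 := by
      simpa [c] using congrArg (Polynomial.aeval b) (bernsteinPolynomial.sum ℝ n)
    have h₁ : ∑ k ∈ Finset.range (n + 1), k • c k = n • b := by
      simpa [c] using congrArg (Polynomial.aeval b) (bernsteinPolynomial.sum_smul ℝ n)
    have h₂ : ∑ k ∈ Finset.range (n + 1), (k * (k - 1)) • c k = (n * (n - 1)) • b ^ 2 := by
      simpa only [c, map_sum, map_nsmul, map_pow, Polynomial.aeval_X] using
        congrArg (Polynomial.aeval b) (bernsteinPolynomial.sum_mul_smul ℝ n)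
    have h₃ : ∑ k ∈ Finset.range (n + 1), (k ^ 2) • c k = (n * (n - 1)) • b ^ 2 + n • b := by
      rw [← h₂, ← h₁, ← Finset.sum_add_distrib]
      refine Finset.sum_congr rfl fun k _ => ?_
      rw [← add_nsmul]
      congr 1
      cases k <;> simp; ring
    have key := sq_sum_nsmul_le (fun k => Φ (c k))
      (fun k => Φ.map_nonneg (aeval_bernsteinPolynomial_nonneg hb hb1 n k))
      (n := n + 1) (by rw [← map_sum, h₀, hΦ])
    simp_rw [← map_nsmul, ← map_sum, h₁, h₃] at key
    have hpos : (0 : ℝ) < (m : ℝ) + 1 := by positivity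
    have key' := smul_le_smul_of_nonneg_left key (a := (((m : ℝ) + 1) ^ 2)⁻¹) (by positivity)
    convert key' using 1
    · rw [map_nsmul, ← Nat.cast_smul_eq_nsmul ℝ, smul_pow, smul_smul, hn]
      push_cast
      rw [inv_mul_cancel₀ (by positivity), one_smul]
    · rw [map_add, map_nsmul, map_nsmul, ← Nat.cast_smul_eq_nsmul ℝ, ← Nat.cast_smul_eq_nsmul ℝ, hn,
        Nat.add_sub_cancel]
      push_cast
      match_scalars
      · field_simp
        ring
      · field_simp
  have lim : Filter.Tendsto (fun n : ℕ => Φ (b ^ 2) + ((n : ℝ) + 1)⁻¹ • (Φ b - Φ (b ^ 2)))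
      Filter.atTop (nhds (Φ (b ^ 2))) := by
    have := (tendsto_one_div_add_atTop_nhds_zero_nat (𝕜 := ℝ)).smul_const (Φ b - Φ (b ^ 2))
    simpa using this.const_add (Φ (b ^ 2))
  exact ge_of_tendsto' lim bound

/-- **Kadison's inequality** for nonnegative elements. -/
lemma map_sq_le (Φ : A →ₚ[ℂ] B) (hΦ : Φ 1 = 1) {b : A} (hb : 0 ≤ b) :
    Φ b ^ 2 ≤ Φ (b ^ 2) := by
  rcases eq_or_ne b 0 with rfl | hb0
  · simp
  have hn : 0 < ‖b‖ := norm_pos_iff.mpr hb0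
  have h := map_sq_le_of_le_one Φ hΦ (b := ((‖b‖⁻¹ : ℝ) : ℂ) • b)
    (by rw [Complex.coe_smul]; exact smul_nonneg (by positivity) hb) (by
      rw [Complex.coe_smul, ← CStarAlgebra.norm_le_one_iff_of_nonneg _
        (smul_nonneg (by positivity) hb), norm_smul]
      simp [hn.ne'])
  rw [smul_pow, map_smul, map_smul, smul_pow, ← Complex.ofReal_pow, Complex.coe_smul,
    Complex.coe_smul] at h
  exact (smul_le_smul_iff_of_pos_left (by positivity)).mp h

lemma map_isStrictlyPositive (Φ : A →ₚ[ℂ] B) (hΦ : Φ 1 = 1) {a : A}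
    (ha : IsStrictlyPositive a) : IsStrictlyPositive (Φ a) := by
  nontriviality B
  have : Nontrivial A := ⟨0, 1, fun h => zero_ne_one (α := B) (by simpa [hΦ] using congrArg Φ h)⟩
  obtain ⟨r, hr, hra⟩ := (CFC.exists_pos_algebraMap_le_iff ha.isSelfAdjoint).2
    fun x hx ↦ ha.spectrum_pos hx
  refine IsStrictlyPositive.of_le (a := algebraMap ℝ B r) ?_ ?_
  · grind
  · simpa only [map_algebraMap Φ hΦ] using OrderHomClass.mono Φ hra

/-- The map `x ↦ Φ(a)^(-1/2) Φ(a^(1/2) x a^(1/2)) Φ(a)^(-1/2)` is again unital and positive. -/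
lemma exists_unital_conj (Φ : A →ₚ[ℂ] B) (hΦ : Φ 1 = 1) {a : A} (ha : IsStrictlyPositive a) :
    ∃ Ψ : A →ₚ[ℂ] B, Ψ 1 = 1 ∧ ∀ r : ℝ,
      Ψ (a ^ r) = Φ a ^ (-(1 / 2) : ℝ) * Φ (a ^ (1 + r)) * Φ a ^ (-(1 / 2) : ℝ) := by
  have hY := map_isStrictlyPositive Φ hΦ ha
  let s := a ^ (1 / 2 : ℝ)
  let c := Φ a ^ (-(1 / 2) : ℝ)
  have hs : IsSelfAdjoint s := .of_nonneg CFC.rpow_nonneg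
  have hc : IsSelfAdjoint c := .of_nonneg CFC.rpow_nonneg
  let Ψ : A →ₚ[ℂ] B := .mk₀
    (LinearMap.mulLeftRight ℂ (c, c) ∘ₗ (Φ : A →ₗ[ℂ] B) ∘ₗ LinearMap.mulLeftRight ℂ (s, s))
    fun x hx => hc.conjugate_nonneg (Φ.map_nonneg (hs.conjugate_nonneg hx))
  have hΨ : ∀ r : ℝ, Ψ (a ^ r) = c * Φ (a ^ (1 + r)) * c := by
    intro r
    change c * Φ (s * a ^ r * s) * c = _
    rw [← CFC.rpow_add ha.isUnit, ← CFC.rpow_add ha.isUnit]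
    ring_nf
  refine ⟨Ψ, ?_, hΨ⟩
  have h := hΨ 0
  rw [CFC.rpow_zero a ha.nonneg, add_zero, CFC.rpow_one a ha.nonneg] at h
  rw [h]
  change Φ a ^ (-(1 / 2) : ℝ) * Φ a * Φ a ^ (-(1 / 2) : ℝ) = 1
  nth_rw 2 [← CFC.rpow_one (Φ a) hY.nonneg]
  rw [← CFC.rpow_add hY.isUnit, ← CFC.rpow_add hY.isUnit]
  norm_num [CFC.rpow_zero (Φ a) hY.nonneg]

lemma rpow_one_add_le_of_rpow_le_conj {y z : B} (hy : IsStrictlyPositive y) {r : ℝ}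
    (h : y ^ r ≤ y ^ (-(1 / 2) : ℝ) * z * y ^ (-(1 / 2) : ℝ)) : y ^ (1 + r) ≤ z := by
  have h' := IsSelfAdjoint.conjugate_le_conjugate h
    (c := y ^ (1 / 2 : ℝ)) (.of_nonneg CFC.rpow_nonneg)
  have e₁ : y ^ (1 / 2 : ℝ) * y ^ (-(1 / 2) : ℝ) = 1 := CFC.rpow_mul_rpow_neg _ hy
  have e₂ : y ^ (-(1 / 2) : ℝ) * y ^ (1 / 2 : ℝ) = 1 := CFC.rpow_neg_mul_rpow _ hy
  calc y ^ (1 + r) = y ^ (1 / 2 : ℝ) * y ^ r * y ^ (1 / 2 : ℝ) := by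
        rw [← CFC.rpow_add hy.isUnit, ← CFC.rpow_add hy.isUnit]; ring_nf
    _ ≤ _ := h'
    _ = (y ^ (1 / 2 : ℝ) * y ^ (-(1 / 2) : ℝ)) * z * (y ^ (-(1 / 2) : ℝ) * y ^ (1 / 2 : ℝ)) := by
        simp only [mul_assoc]
    _ = z := by rw [e₁, e₂, one_mul, mul_one]

/-- **Choi's inequality** `Φ(a)⁻¹ ≤ Φ(a⁻¹)`. -/
lemma ringInverse_map_le (Φ : A →ₚ[ℂ] B) (hΦ : Φ 1 = 1) {a : A} (ha : IsStrictlyPositive a) :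
    (Φ a)⁻¹ʳ ≤ Φ a⁻¹ʳ := by
  have hY := map_isStrictlyPositive Φ hΦ ha
  obtain ⟨Ψ, hΨ1, hΨ⟩ := exists_unital_conj Φ hΦ ha
  have key := map_sq_le Ψ hΨ1 (CFC.rpow_nonneg (a := a) (y := -1))
  rw [hΨ, add_neg_cancel, CFC.rpow_zero a ha.nonneg, hΦ, mul_one, ← CFC.rpow_add hY.isUnit,
    sq, sq, ← CFC.rpow_add hY.isUnit, ← CFC.rpow_add ha.isUnit, hΨ] at key
  rw [CFC.inverse_eq_rpow_neg_one hY, CFC.inverse_eq_rpow_neg_one ha]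
  convert rpow_one_add_le_of_rpow_le_conj hY key using 2 <;> norm_num

lemma cfc_rpowIntegrand₀₁_eq {p t : ℝ} (hp : p ≠ 1) (ht : 0 < t) {x : A} (hx : 0 ≤ x) :
    cfc (Real.rpowIntegrand₀₁ p t) x =
      algebraMap ℝ A (t ^ (p - 1)) - t ^ p • (algebraMap ℝ A t + x)⁻¹ʳ := by
  rw [Real.rpowIntegrand₀₁_eq_sub hp ht]
  have hg : ContinuousOn (fun z : ℝ => (t + z)⁻¹) (spectrum ℝ x) := by
    fun_prop (disch := grind -abstractProof)
  have hgc : ContinuousOn (fun z : ℝ => t ^ p * (t + z)⁻¹) (spectrum ℝ x) := by fun_prop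
  have hspectrum : ∀ r ∈ spectrum ℝ x, t + r ≠ 0 := by grind
  rw [cfc_sub (fun _ : ℝ => t ^ (p - 1)) (fun z : ℝ => t ^ p * (t + z)⁻¹) x
      (by fun_prop) hgc, cfc_const ..,
    cfc_const_mul _ _ _ hg, cfc_inv _ _ hspectrum (by fun_prop), cfc_const_add .., cfc_id' ..]

lemma map_cfc_rpowIntegrand₀₁_le (Φ : A →ₚ[ℂ] B) (hΦ : Φ 1 = 1) {p t : ℝ} (hp : p ≠ 1)
    (ht : 0 < t) {a : A} (ha : 0 ≤ a) :
    Φ (cfc (Real.rpowIntegrand₀₁ p t) a) ≤ cfc (Real.rpowIntegrand₀₁ p t) (Φ a) := by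
  rw [cfc_rpowIntegrand₀₁_eq hp ht ha, cfc_rpowIntegrand₀₁_eq hp ht (Φ.map_nonneg ha), map_sub,
    map_algebraMap Φ hΦ, ← Complex.coe_smul, map_smul, Complex.coe_smul]
  have hta : IsStrictlyPositive (algebraMap ℝ A t + a) := by grind
  have := ringInverse_map_le Φ hΦ hta
  rw [map_add, map_algebraMap Φ hΦ] at this
  gcongr

/-- **Jensen's operator inequality** for the operator concave function `x ↦ x ^ p`, `0 ≤ p ≤ 1`. -/
lemma map_rpow_le (Φ : A →ₚ[ℂ] A) (hΦ : Φ 1 = 1) {p : ℝ} (hp0 : 0 ≤ p) (hp1 : p ≤ 1) {a : A}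
    (ha : 0 ≤ a) : Φ (a ^ p) ≤ Φ a ^ p := by
  have hY := Φ.map_nonneg ha
  rcases hp0.eq_or_lt with rfl | hp0
  · rw [CFC.rpow_zero a, CFC.rpow_zero (Φ a), hΦ]
  rcases hp1.eq_or_lt with rfl | hp1
  · rw [CFC.rpow_one a, CFC.rpow_one (Φ a)]
  lift p to ℝ≥0 using hp0.le
  have hp : p ∈ Set.Ioo 0 1 := ⟨by exact_mod_cast hp0, by exact_mod_cast hp1⟩
  have hp' : (p : ℝ) ∈ Set.Ioo 0 1 := ⟨hp0, hp1⟩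
  obtain ⟨μ, hμ⟩ := CFC.exists_measure_nnrpow_eq_integral_cfcₙ_rpowIntegrand₀₁ A hp
  let Φc : A →L[ℝ] A := ContinuousLinearMap.restrictScalars ℝ ⟨Φ.toLinearMap, map_continuous Φ⟩
  rw [← CFC.nnrpow_eq_rpow hp.1, ← CFC.nnrpow_eq_rpow hp.1, (hμ a ha).2, (hμ (Φ a) hY).2]
  change Φc _ ≤ _
  rw [← Φc.integral_comp_comm (hμ a ha).1]
  refine setIntegral_mono_on (Φc.integrable_comp (hμ a ha).1) (hμ (Φ a) hY).1 measurableSet_Ioi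
    fun t ht => ?_
  have hcont : ContinuousOn (Real.rpowIntegrand₀₁ p t) (Set.Ici 0) :=
    Real.continuousOn_rpowIntegrand₀₁_Ici hp' ht
  rw [cfcₙ_eq_cfc (hf := hcont.mono (by grind)), cfcₙ_eq_cfc (hf := hcont.mono (by grind))]
  exact map_cfc_rpowIntegrand₀₁_le Φ hΦ hp1.ne ht ha

/-- **Jensen's operator inequality** for the operator convex function `x ↦ x ^ (1 + p)`,
`0 ≤ p ≤ 1`. -/
lemma rpow_one_add_map_le (Φ : A →ₚ[ℂ] A) (hΦ : Φ 1 = 1) {p : ℝ} (hp0 : 0 ≤ p) (hp1 : p ≤ 1)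
    {a : A} (ha : IsStrictlyPositive a) : Φ a ^ (1 + p) ≤ Φ (a ^ (1 + p)) := by
  have hY := map_isStrictlyPositive Φ hΦ ha
  rcases eq_or_ne p 0 with rfl | hp
  · rw [add_zero, CFC.rpow_one a ha.nonneg, CFC.rpow_one (Φ a) hY.nonneg]
  obtain ⟨Ψ, hΨ1, hΨ⟩ := exists_unital_conj Φ hΦ ha
  refine rpow_one_add_le_of_rpow_le_conj hY ?_
  rw [← hΨ]
  have hap : IsStrictlyPositive (a ^ (-p)) := .rpow a _ ha
  have concave : Ψ (a ^ (-p)) ≤ Φ a ^ (-p) := by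
    have h := map_rpow_le Ψ hΨ1 hp0 hp1 (CFC.rpow_nonneg (a := a) (y := -1))
    rw [CFC.rpow_rpow a _ _ (by norm_num) ha, hΨ (-1), add_neg_cancel, CFC.rpow_zero a ha.nonneg, hΦ,
      mul_one, ← CFC.rpow_add hY.isUnit, CFC.rpow_rpow _ _ _ (by norm_num) hY] at h
    convert h using 2 <;> ring_nf
  calc Φ a ^ p = (Φ a ^ (-p))⁻¹ʳ := by
        rw [CFC.inverse_rpow _ _ (neg_ne_zero.mpr hp) hY, neg_neg]
    _ ≤ (Ψ (a ^ (-p)))⁻¹ʳ :=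
        CStarAlgebra.ringInverse_le_ringInverse concave (map_isStrictlyPositive Ψ hΨ1 hap)
    _ ≤ Ψ (a ^ (-p))⁻¹ʳ := ringInverse_map_le Ψ hΨ1 hap
    _ = Ψ (a ^ p) := by rw [CFC.inverse_rpow _ _ (neg_ne_zero.mpr hp) ha, neg_neg]

end PositiveLinearMap

/-- **Corollary 2.7, first inequality.** `|Φ(A^γ) Φ(A)| ≤ Φ(A^(γ+1))` for each unital positive
linear map `Φ`, each positive invertible operator `A`, and each `0 ≤ γ ≤ 1/2`. -/
theorem abs_power_le_choi_davis
    (Φ : (H →L[ℂ] H) →ₗ[ℂ] (H →L[ℂ] H)) (hΦ : IsUnitalPositiveMap Φ)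
    (γ : ℝ) (hγ0 : 0 ≤ γ) (hγ1 : γ ≤ 1 / 2)
    (A : H →L[ℂ] H) (hA : 0 ≤ A) (hAu : IsUnit A) :
    opAbs (Φ (CFC.rpow A γ) * Φ A) ≤ Φ (CFC.rpow A (γ + 1)) := by
  let Ψ : (H →L[ℂ] H) →ₚ[ℂ] (H →L[ℂ] H) := .mk₀ Φ hΦ.2
  have hΨ : Ψ 1 = 1 := hΦ.1
  have hA' : IsStrictlyPositive A := hAu.isStrictlyPositive hA
  have hY := Ψ.map_isStrictlyPositive hΨ hA'
  change CFC.sqrt (star (Ψ (A ^ γ) * Ψ A) * (Ψ (A ^ γ) * Ψ A)) ≤ Ψ (A ^ (γ + 1))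
  have hX : IsSelfAdjoint (Ψ (A ^ γ)) := .of_nonneg (Ψ.map_nonneg CFC.rpow_nonneg)
  have sq_le : Ψ (A ^ γ) ^ 2 ≤ Ψ A ^ (γ + γ) := by
    refine (Ψ.map_sq_le hΨ CFC.rpow_nonneg).trans ?_
    rw [sq, ← CFC.rpow_add hAu]
    exact Ψ.map_rpow_le hΨ (by linarith) (by linarith) hA
  have le : star (Ψ (A ^ γ) * Ψ A) * (Ψ (A ^ γ) * Ψ A) ≤ Ψ A ^ (1 + γ) * Ψ A ^ (1 + γ) := by
    calc _ = Ψ A * Ψ (A ^ γ) ^ 2 * Ψ A := by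
          rw [star_mul, hX.star_eq, hY.isSelfAdjoint.star_eq]; noncomm_ring
      _ ≤ Ψ A * Ψ A ^ (γ + γ) * Ψ A :=
          IsSelfAdjoint.conjugate_le_conjugate sq_le hY.isSelfAdjoint
      _ = Ψ A ^ (1 : ℝ) * Ψ A ^ (γ + γ) * Ψ A ^ (1 : ℝ) := by rw [CFC.rpow_one _ hY.nonneg]
      _ = Ψ A ^ (1 + γ) * Ψ A ^ (1 + γ) := by
          simp only [← CFC.rpow_add hY.isUnit]; ring_nf
  calc _ ≤ CFC.sqrt (Ψ A ^ (1 + γ) * Ψ A ^ (1 + γ)) := CFC.sqrt_le_sqrt _ _ le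
    _ = Ψ A ^ (1 + γ) := CFC.sqrt_mul_self _ CFC.rpow_nonneg
    _ ≤ Ψ (A ^ (1 + γ)) := Ψ.rpow_one_add_map_le hΨ hγ0 (by linarith) hA'
    _ = Ψ (A ^ (γ + 1)) := by rw [add_comm]
end
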